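/- arXiv:1004.3603 — 2 statements merged into one kernel-verified Lean document; each statement's English description precedes it below -/
import Mathlib

section
/- Let F be a field of characteristic different from 2 and let M be an n×n matrix over F. Then M ∉ Ξ_n(F) if and only if the pair (Mᵀ, M) has a direct summand for equivalence of the form (Γ_rᵀ, Γ_r) with r odd, or of the form (J_s(0)ᵀ, J_s(0)) with s odd. -/
open Matrix Polynomial

variable {F : Type*} [Field F]

/-- `M ∈ Ξ_n(F)`: every invertible `S` with `SᵀMS = M` has `det S = 1`. -/
def XiMem {n : ℕ} (M : Matrix (Fin n) (Fin n) F) : Prop :=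
  ∀ S : Matrix (Fin n) (Fin n) F, IsUnit S → Sᵀ * M * S = M → S.det = 1

/-- Congruence of square matrices: `SᵀAS = B` for some invertible `S`. -/
def MatCongruent {n : ℕ} (A B : Matrix (Fin n) (Fin n) F) : Prop :=
  ∃ S : Matrix (Fin n) (Fin n) F, IsUnit S ∧ Sᵀ * A * S = B

/-- Similarity of square matrices: `S⁻¹AS = B` for some invertible `S`. -/
def MatSimilar {n : ℕ} (A B : Matrix (Fin n) (Fin n) F) : Prop :=
  ∃ S : Matrix (Fin n) (Fin n) F, IsUnit S ∧ S⁻¹ * A * S = B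

/-- Block-diagonal direct sum `A ⊕ B`. -/
def dSum {a b : ℕ} (A : Matrix (Fin a) (Fin a) F) (B : Matrix (Fin b) (Fin b) F) :
    Matrix (Fin (a + b)) (Fin (a + b)) F :=
  Matrix.reindex finSumFinEquiv finSumFinEquiv (Matrix.fromBlocks A 0 0 B)

/-- Skew sum `[A ╲ B] = [[0, B], [A, 0]]` of two `m × m` matrices. -/
def skewSum {m : ℕ} (A B : Matrix (Fin m) (Fin m) F) :
    Matrix (Fin (m + m)) (Fin (m + m)) F :=
  Matrix.reindex finSumFinEquiv finSumFinEquiv (Matrix.fromBlocks 0 B A 0)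

/-- `A` is a direct summand of `M` for congruence. -/
def CongSummand {n r : ℕ} (M : Matrix (Fin n) (Fin n) F)
    (A : Matrix (Fin r) (Fin r) F) : Prop :=
  ∃ (s : ℕ) (h : r + s = n) (B : Matrix (Fin s) (Fin s) F),
    MatCongruent M (Matrix.reindex (finCongr h) (finCongr h) (dSum A B))

/-- `A` is a direct summand of `M` for similarity. -/
def SimSummand {n r : ℕ} (M : Matrix (Fin n) (Fin n) F)
    (A : Matrix (Fin r) (Fin r) F) : Prop :=
  ∃ (s : ℕ) (h : r + s = n) (B : Matrix (Fin s) (Fin s) F),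
    MatSimilar M (Matrix.reindex (finCongr h) (finCongr h) (dSum A B))

/-- `(A, B)` is a direct summand of the pair `(M, N)` for equivalence:
`(M, N)` is equivalent to `(A, B) ⊕ (C, D)` for some pair `(C, D)`. -/
def PairSummand {n a b : ℕ} (M N : Matrix (Fin n) (Fin n) F)
    (A B : Matrix (Fin a) (Fin b) F) : Prop :=
  ∃ (c d : ℕ) (hc : a + c = n) (hd : b + d = n)
    (C D : Matrix (Fin c) (Fin d) F)
    (R S : Matrix (Fin n) (Fin n) F), IsUnit R ∧ IsUnit S ∧
      R * M * S = Matrix.reindex (finSumFinEquiv.trans (finCongr hc))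
          (finSumFinEquiv.trans (finCongr hd)) (Matrix.fromBlocks A 0 0 C) ∧
      R * N * S = Matrix.reindex (finSumFinEquiv.trans (finCongr hc))
          (finSumFinEquiv.trans (finCongr hd)) (Matrix.fromBlocks B 0 0 D)

/-- The `r × r` Jordan block `J_r(λ)`: `λ` on the diagonal, `1` on the subdiagonal. -/
def jordanBlock (r : ℕ) (lam : F) : Matrix (Fin r) (Fin r) F :=
  Matrix.of fun i j =>
    if (i : ℕ) = (j : ℕ) then lam else if (i : ℕ) = (j : ℕ) + 1 then 1 else 0

/-- The matrix `Γ_r`: with 1-based indices, entry `(i, j)` is `(-1)^(r - i)` if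
`i + j = r + 1` or `i + j = r + 2`, and `0` otherwise. -/
def Gam (r : ℕ) : Matrix (Fin r) (Fin r) F :=
  Matrix.of fun i j =>
    if (i : ℕ) + (j : ℕ) = r - 1 ∨ (i : ℕ) + (j : ℕ) = r then
      (-1 : F) ^ (r - 1 - (i : ℕ)) else 0

/-- Companion matrix of a monic polynomial `x^m + c₁x^(m-1) + ⋯ + c_m`:
`1`'s on the subdiagonal, last column `(-c_m, …, -c₂, -c₁)ᵀ`. -/
def companion (q : Polynomial F) : Matrix (Fin q.natDegree) (Fin q.natDegree) F :=
  Matrix.of fun i j =>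
    if (j : ℕ) = q.natDegree - 1 then -q.coeff (i : ℕ)
    else if (i : ℕ) = (j : ℕ) + 1 then 1 else 0

/-- A Frobenius block: the companion matrix of `p^l` with `p` monic irreducible, `l ≥ 1`. -/
def IsFrobeniusBlock {m : ℕ} (A : Matrix (Fin m) (Fin m) F) : Prop :=
  ∃ (p : Polynomial F) (l : ℕ), p.Monic ∧ Irreducible p ∧ 1 ≤ l ∧
    ∃ h : (p ^ l).natDegree = m,
      A = Matrix.reindex (finCongr h) (finCongr h) (companion (p ^ l))

/-- `Φ` is a cosquare: `Φ = A⁻ᵀA` for some invertible `A`. -/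
def IsCosquare {m : ℕ} (A : Matrix (Fin m) (Fin m) F) : Prop :=
  ∃ Q : Matrix (Fin m) (Fin m) F, IsUnit Q ∧ Q⁻¹ᵀ * Q = A

/-- The `(t-1) × t` matrix `F_t` with `F_t(i, j) = 1` iff `j = i`. -/
def Fmat (t : ℕ) : Matrix (Fin (t - 1)) (Fin t) F :=
  Matrix.of fun i j => if (j : ℕ) = (i : ℕ) then 1 else 0

/-- The `(t-1) × t` matrix `G_t` with `G_t(i, j) = 1` iff `j = i + 1`. -/
def Gmat (t : ℕ) : Matrix (Fin (t - 1)) (Fin t) F :=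
  Matrix.of fun i j => if (j : ℕ) = (i : ℕ) + 1 then 1 else 0

section Splitting

variable {n r : ℕ}

/-- An idempotent matrix factors through a coordinate space on which it is the identity. -/
theorem exists_factor_of_idempotent (E : Matrix (Fin n) (Fin n) F) (hE : E * E = E) :
    ∃ (c : ℕ) (Y : Matrix (Fin n) (Fin c) F) (p : Matrix (Fin c) (Fin n) F),
      p * Y = 1 ∧ Y * p = E := by
  set f := Matrix.toLin' E with hf
  let b := Module.finBasis F (LinearMap.range f)
  refine ⟨_, LinearMap.toMatrix' ((LinearMap.range f).subtype ∘ₗ b.equivFun.symm.toLinearMap),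
    LinearMap.toMatrix' (b.equivFun.toLinearMap ∘ₗ f.rangeRestrict), ?_, ?_⟩
  · rw [← LinearMap.toMatrix'_comp, ← LinearMap.toMatrix'_id]
    congr 1
    refine LinearMap.ext fun z => ?_
    have h : f.rangeRestrict ((b.equivFun.symm z : LinearMap.range f) : Fin n → F)
        = b.equivFun.symm z := by
      obtain ⟨w, hw⟩ := (b.equivFun.symm z).2
      apply Subtype.ext
      rw [← hw]
      change f (f w) = f w
      rw [hf, ← LinearMap.comp_apply, ← Matrix.toLin'_mul, hE]
    simp only [LinearMap.comp_apply, Submodule.subtype_apply, LinearEquiv.coe_coe,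
      LinearMap.id_apply]
    rw [h, LinearEquiv.apply_symm_apply]
  · rw [← LinearMap.toMatrix'_comp]
    have : ((LinearMap.range f).subtype ∘ₗ b.equivFun.symm.toLinearMap) ∘ₗ
        (b.equivFun.toLinearMap ∘ₗ f.rangeRestrict) = f := by
      refine LinearMap.ext fun w => ?_
      simp
    rw [this, hf, LinearMap.toMatrix'_toLin']

/-- A matrix `Y` with left inverse `p` is completed to a basis by a basis of `ker p`. -/
theorem exists_complement {p : Matrix (Fin r) (Fin n) F} {Y : Matrix (Fin n) (Fin r) F}
    (h : p * Y = 1) :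
    ∃ (c : ℕ) (_ : r + c = n) (Y' : Matrix (Fin n) (Fin c) F) (p' : Matrix (Fin c) (Fin n) F),
      p * Y' = 0 ∧ p' * Y = 0 ∧ p' * Y' = 1 ∧ Y * p + Y' * p' = 1 := by
  have hid : (1 - Y * p) * (1 - Y * p) = 1 - Y * p := by
    have : Y * p * (Y * p) = Y * p := by
      rw [Matrix.mul_assoc, ← Matrix.mul_assoc p, h, Matrix.one_mul]
    rw [sub_mul, mul_sub, mul_sub, this]
    simp
  obtain ⟨c, Y', p', h1, h2⟩ := exists_factor_of_idempotent _ hid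
  have hp : p * Y' = 0 := by
    calc p * Y' = p * Y' * (p' * Y') := by rw [h1, Matrix.mul_one]
      _ = p * (Y' * p') * Y' := by simp only [Matrix.mul_assoc]
      _ = 0 := by rw [h2, Matrix.mul_sub, ← Matrix.mul_assoc p, h]; simp
  have hY : p' * Y = 0 := by
    calc p' * Y = p' * Y' * (p' * Y) := by rw [h1, Matrix.one_mul]
      _ = p' * ((Y' * p') * Y) := by simp only [Matrix.mul_assoc]
      _ = 0 := by rw [h2, Matrix.sub_mul, Matrix.mul_assoc Y, h]; simp
  have hsum : Y * p + Y' * p' = 1 := by rw [h2]; abel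
  refine ⟨c, ?_, Y', p', hp, hY, h1, hsum⟩
  have e := Matrix.toLin'OfInv (M := fromCols Y Y') (M' := fromRows p p')
    (by rw [fromCols_mul_fromRows, hsum])
    (by rw [fromRows_mul_fromCols, h, h1, hp, hY, fromBlocks_one])
  simpa using e.finrank_eq.symm

/-- Recognition of a direct summand of a pair from its two inclusions and two projections. -/
theorem pairSummand_of_split {M N : Matrix (Fin n) (Fin n) F} {A B : Matrix (Fin r) (Fin r) F}
    {X p : Matrix (Fin r) (Fin n) F} {Y q : Matrix (Fin n) (Fin r) F}
    (hp : p * Y = 1) (hq : X * q = 1) (hXM : X * M = A * p) (hXN : X * N = B * p)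
    (hMY : M * Y = q * A) (hNY : N * Y = q * B) : PairSummand M N A B := by
  obtain ⟨d, hd, Y', p', h1, h2, h3, h4⟩ := exists_complement hp
  obtain ⟨c, hc, q', X', k1, k2, k3, k4⟩ := exists_complement hq
  have key : ∀ (L : Matrix (Fin n) (Fin n) F) (D : Matrix (Fin r) (Fin r) F),
      X * L = D * p → L * Y = q * D →
      (fromRows X X').submatrix (finSumFinEquiv.trans (finCongr hc)).symm id * L *
        (fromCols Y Y').submatrix id (finSumFinEquiv.trans (finCongr hd)).symm =
      Matrix.reindex (finSumFinEquiv.trans (finCongr hc)) (finSumFinEquiv.trans (finCongr hd))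
        (fromBlocks D 0 0 (X' * L * Y')) := by
    intro L D hX hY
    have : fromRows X X' * L * fromCols Y Y' = fromBlocks D 0 0 (X' * L * Y') := by
      rw [fromRows_mul, fromRows_mul_fromCols, hX, Matrix.mul_assoc D, Matrix.mul_assoc D, hp, h1,
        Matrix.mul_assoc X', hY, ← Matrix.mul_assoc X', k2]
      simp
    rw [← this]
    rfl
  refine ⟨c, d, hc, hd, X' * M * Y', X' * N * Y', _, _, ?_, ?_, key M A hXM hMY, key N B hXN hNY⟩
  · refine IsUnit.of_mul_eq_one
      ((fromCols q q').submatrix id (finSumFinEquiv.trans (finCongr hc)).symm) ?_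
    have : fromRows X X' * fromCols q q' = 1 := by
      rw [fromRows_mul_fromCols, hq, k1, k2, k3, fromBlocks_one]
    rw [← Matrix.submatrix_mul _ _ _ id _ Function.bijective_id, this, submatrix_one_equiv]
  · refine IsUnit.of_mul_eq_one_right
      ((fromRows p p').submatrix (finSumFinEquiv.trans (finCongr hd)).symm id) ?_
    have : fromRows p p' * fromCols Y Y' = 1 := by
      rw [fromRows_mul_fromCols, hp, h1, h2, h3, fromBlocks_one]
    rw [← Matrix.submatrix_mul _ _ _ id _ Function.bijective_id, this, submatrix_one_equiv]

/-- Converse of `pairSummand_of_split`. -/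
theorem PairSummand.exists_split {M N : Matrix (Fin n) (Fin n) F}
    {A B : Matrix (Fin r) (Fin r) F} (h : PairSummand M N A B) :
    ∃ (X p : Matrix (Fin r) (Fin n) F) (Y q : Matrix (Fin n) (Fin r) F),
      p * Y = 1 ∧ X * q = 1 ∧ X * M = A * p ∧ X * N = B * p ∧ M * Y = q * A ∧ N * Y = q * B := by
  obtain ⟨c, d, hc, hd, C, D, R, S, hR, hS, hM, hN⟩ := h
  rw [Matrix.isUnit_iff_isUnit_det] at hR hS
  set e := finSumFinEquiv.trans (finCongr hc) with he
  set e' := finSumFinEquiv.trans (finCongr hd) with he'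
  have left : ∀ (L : Matrix (Fin n) (Fin n) F) (G : Matrix (Fin r) (Fin r) F)
      (G' : Matrix (Fin c) (Fin d) F),
      R * L * S = Matrix.reindex e e' (fromBlocks G 0 0 G') →
      R.submatrix (e ∘ Sum.inl) id * L = G * S⁻¹.submatrix (e' ∘ Sum.inl) id := by
    intro L G G' hL
    have h1 : R * L = Matrix.reindex e e' (fromBlocks G 0 0 G') * S⁻¹ := by
      rw [← hL, Matrix.mul_nonsing_inv_cancel_right _ _ hS]
    ext i j
    have h2 := congr_fun (congr_fun h1 (e (Sum.inl i))) j
    simp only [Matrix.mul_apply, ← e'.sum_comp, Fintype.sum_sum_type] at h2 ⊢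
    simpa using h2
  have right : ∀ (L : Matrix (Fin n) (Fin n) F) (G : Matrix (Fin r) (Fin r) F)
      (G' : Matrix (Fin c) (Fin d) F),
      R * L * S = Matrix.reindex e e' (fromBlocks G 0 0 G') →
      L * S.submatrix id (e' ∘ Sum.inl) = R⁻¹.submatrix id (e ∘ Sum.inl) * G := by
    intro L G G' hL
    have h1 : L * S = R⁻¹ * Matrix.reindex e e' (fromBlocks G 0 0 G') := by
      rw [← hL, Matrix.mul_assoc, Matrix.nonsing_inv_mul_cancel_left _ _ hR]
    ext i j
    have h2 := congr_fun (congr_fun h1 i) (e' (Sum.inl j))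
    simp only [Matrix.mul_apply, ← e.sum_comp, Fintype.sum_sum_type] at h2 ⊢
    simpa using h2
  refine ⟨R.submatrix (e ∘ Sum.inl) id, S⁻¹.submatrix (e' ∘ Sum.inl) id,
    S.submatrix id (e' ∘ Sum.inl), R⁻¹.submatrix id (e ∘ Sum.inl), ?_, ?_,
    left _ _ _ hM, left _ _ _ hN, right _ _ _ hM, right _ _ _ hN⟩
  · rw [← Matrix.submatrix_mul _ _ _ id _ Function.bijective_id, Matrix.nonsing_inv_mul _ hS,
      submatrix_one _ (e'.injective.comp Sum.inl_injective)]
  · rw [← Matrix.submatrix_mul _ _ _ id _ Function.bijective_id, Matrix.mul_nonsing_inv _ hR,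
      submatrix_one _ (e.injective.comp Sum.inl_injective)]

/-- An orthogonal summand of odd size is negated by an isometry of determinant `-1`. -/
theorem not_xiMem_of_split (hchar : (2 : F) ≠ 0) {M : Matrix (Fin n) (Fin n) F}
    {A : Matrix (Fin r) (Fin r) F} {p : Matrix (Fin r) (Fin n) F} {Y : Matrix (Fin n) (Fin r) F}
    (hr : Odd r) (hp : p * Y = 1) (hl : Yᵀ * M = A * p) (hm : M * Y = pᵀ * A) :
    ¬ XiMem M := by
  intro hxi
  have hdet : (1 - Y * ((2 : F) • p)).det = -1 := by
    rw [Matrix.det_one_sub_mul_comm, Matrix.smul_mul, hp]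
    have : (1 : Matrix (Fin r) (Fin r) F) - (2 : F) • 1 = -1 := by
      rw [two_smul]; abel
    rw [this, Matrix.det_neg, Matrix.det_one, Fintype.card_fin, hr.neg_one_pow, mul_one]
  have hiso : (1 - Y * ((2 : F) • p))ᵀ * M * (1 - Y * ((2 : F) • p)) = M := by
    have h1 : pᵀ * Yᵀ * M = pᵀ * A * p := by rw [Matrix.mul_assoc, hl, Matrix.mul_assoc]
    have h2 : M * (Y * p) = pᵀ * A * p := by rw [← Matrix.mul_assoc, hm]
    have h3 : pᵀ * A * p * (Y * p) = pᵀ * A * p := by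
      rw [← Matrix.mul_assoc, Matrix.mul_assoc _ p Y, hp, Matrix.mul_one]
    simp only [Matrix.transpose_sub, Matrix.transpose_one, Matrix.transpose_mul,
      Matrix.transpose_add, Matrix.add_mul, Matrix.mul_add, Matrix.sub_mul, Matrix.mul_sub,
      Matrix.one_mul, Matrix.mul_one, h1, h2, h3, two_smul]
    abel
  have := hxi _ ((Matrix.isUnit_iff_isUnit_det _).2 (by rw [hdet]; exact isUnit_one.neg)) hiso
  rw [hdet] at this
  exact hchar (by linear_combination -this)

end Splitting

section ShiftBlocks

variable {n r : ℕ}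

/-- The `r × r` matrix with `1`'s on the superdiagonal and `0`'s elsewhere. -/
def shift (F : Type*) [Field F] (r : ℕ) : Matrix (Fin r) (Fin r) F := (jordanBlock r 0)ᵀ

theorem shift_apply (i j : Fin r) :
    shift F r i j = if (j : ℕ) = (i : ℕ) + 1 then 1 else 0 := by
  simp only [shift, jordanBlock, transpose_apply, of_apply]
  split_ifs <;> first | rfl | omega

theorem mul_shift_apply {m : Type*} (D : Matrix m (Fin r) F) (i : m) (j : Fin r) :
    (D * shift F r) i j = if (j : ℕ) = 0 then 0 else D i ⟨j - 1, by omega⟩ := by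
  simp only [mul_apply, shift_apply, mul_ite, mul_one, mul_zero]
  split_ifs with h
  · exact Finset.sum_eq_zero fun x _ => if_neg (by omega)
  · rw [Finset.sum_eq_single ⟨(j : ℕ) - 1, by omega⟩]
    · exact if_pos (by simp only; omega)
    · intro b _ hb
      exact if_neg fun h' => hb (Fin.ext (by simp only; omega))
    · simp

theorem shift_mul_apply {m : Type*} (D : Matrix (Fin r) m F) (i : Fin r) (j : m) :
    (shift F r * D) i j = if h : (i : ℕ) + 1 < r then D ⟨i + 1, h⟩ j else 0 := by
  simp only [mul_apply, shift_apply, ite_mul, one_mul, zero_mul]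
  split_ifs with h
  · rw [Finset.sum_eq_single ⟨(i : ℕ) + 1, h⟩]
    · simp
    · intro b _ hb
      exact if_neg fun h' => hb (Fin.ext h')
    · simp
  · exact Finset.sum_eq_zero fun x _ => if_neg (by omega)

/-- A matrix commuting with the shift is upper triangular and constant along diagonals, hence
invertible as soon as its corner entry does not vanish. -/
theorem isUnit_det_of_commute_shift {D : Matrix (Fin r) (Fin r) F} (hr : 0 < r)
    (hD : D * shift F r = shift F r * D) (h0 : D ⟨0, hr⟩ ⟨0, hr⟩ ≠ 0) : IsUnit D.det := by
  have step : ∀ (i j : ℕ) (hi : i + 1 < r) (hj : j < r),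
      D ⟨i + 1, hi⟩ ⟨j, hj⟩ = if h : j = 0 then 0 else D ⟨i, by omega⟩ ⟨j - 1, by omega⟩ := by
    intro i j hi hj
    have := congr_fun (congr_fun hD ⟨i, by omega⟩) ⟨j, hj⟩
    rw [mul_shift_apply, shift_mul_apply, dif_pos hi] at this
    rw [← this]
    rfl
  have diag : ∀ (i : ℕ) (hi : i < r), D ⟨i, hi⟩ ⟨i, hi⟩ = D ⟨0, hr⟩ ⟨0, hr⟩ := by
    intro i
    induction i with
    | zero => intro _; rfl
    | succ i ih =>
      intro hi
      rw [step, dif_neg (by omega)]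
      exact ih (by omega)
  have low : ∀ (i j : ℕ) (hi : i < r) (hj : j < r), j < i → D ⟨i, hi⟩ ⟨j, hj⟩ = 0 := by
    intro i
    induction i with
    | zero => intro j _ _ h; omega
    | succ i ih =>
      intro j hi hj h
      rw [step]
      split_ifs with hj0
      · rfl
      · exact ih _ _ _ (by omega)
  have hup : D.IsUpperTriangular := fun i j h => low i j i.2 j.2 h
  rw [Matrix.det_of_isUpperTriangular hup,
    Finset.prod_congr rfl fun (i : Fin r) _ => diag i i.2, Finset.prod_const]
  exact (isUnit_iff_ne_zero.2 h0).pow _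

/-- The pair `(1, shift F r)` is a direct summand of `(H, K)`, expressed by the inclusion `Y`
and the left inclusion `X`. -/
def HasShiftBlock (H K : Matrix (Fin n) (Fin n) F) (r : ℕ) : Prop :=
  ∃ (X : Matrix (Fin r) (Fin n) F) (Y : Matrix (Fin n) (Fin r) F),
    X * H * Y = 1 ∧ K * Y = H * Y * shift F r ∧ X * K = shift F r * (X * H)

theorem commute_shift_of_chains {H K : Matrix (Fin n) (Fin n) F} {X : Matrix (Fin r) (Fin n) F}
    {Y : Matrix (Fin n) (Fin r) F} (hY : K * Y = H * Y * shift F r)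
    (hX : X * K = shift F r * (X * H)) : X * H * Y * shift F r = shift F r * (X * H * Y) := by
  rw [← Matrix.mul_assoc (shift F r), ← hX, Matrix.mul_assoc X K, hY]
  simp only [Matrix.mul_assoc]

theorem hasShiftBlock_of_chains {H K : Matrix (Fin n) (Fin n) F} {X : Matrix (Fin r) (Fin n) F}
    {Y : Matrix (Fin n) (Fin r) F} (hY : K * Y = H * Y * shift F r)
    (hX : X * K = shift F r * (X * H)) (hr : 0 < r) (h0 : (X * H * Y) ⟨0, hr⟩ ⟨0, hr⟩ ≠ 0) :
    HasShiftBlock H K r := by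
  have hc := commute_shift_of_chains hY hX
  set D := X * H * Y with hD
  have hu := isUnit_det_of_commute_shift hr hc h0
  refine ⟨D⁻¹ * X, Y, ?_, hY, ?_⟩
  · rw [Matrix.mul_assoc, Matrix.mul_assoc, ← Matrix.mul_assoc X, ← hD, Matrix.nonsing_inv_mul _ hu]
  · have : D⁻¹ * shift F r = shift F r * D⁻¹ := by
      calc D⁻¹ * shift F r = D⁻¹ * (shift F r * D) * D⁻¹ := by
            rw [← Matrix.mul_assoc, Matrix.mul_nonsing_inv_cancel_right _ _ hu]
        _ = shift F r * D⁻¹ := by rw [← hc, Matrix.nonsing_inv_mul_cancel_left _ _ hu]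
    rw [Matrix.mul_assoc, hX, ← Matrix.mul_assoc, this]
    simp only [Matrix.mul_assoc]

/-- The matrix `K - xH` over `F[x]`. -/
noncomputable def pencil (H K : Matrix (Fin n) (Fin n) F) : Matrix (Fin n) (Fin n) F[X] :=
  K.map C - (X : F[X]) • H.map C

theorem coeff_mul_pencil (H K : Matrix (Fin n) (Fin n) F) (G : Matrix (Fin n) (Fin n) F[X])
    (i : ℕ) : (G * pencil H K).map (fun f => f.coeff (i + 1)) =
      G.map (fun f => f.coeff (i + 1)) * K - G.map (fun f => f.coeff i) * H := by
  ext a b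
  simp only [pencil, Matrix.map_apply, Matrix.mul_apply, Matrix.sub_apply, Matrix.smul_apply,
    smul_eq_mul, mul_sub, coeff_sub, finsetSum_coeff, coeff_mul_C,
    mul_left_comm _ X, coeff_X_mul]

theorem coeff_zero_mul_pencil (H K : Matrix (Fin n) (Fin n) F) (G : Matrix (Fin n) (Fin n) F[X]) :
    (G * pencil H K).map (fun f => f.coeff 0) = G.map (fun f => f.coeff 0) * K := by
  ext a b
  simp only [pencil, Matrix.map_apply, Matrix.mul_apply, Matrix.sub_apply, Matrix.smul_apply,
    smul_eq_mul, mul_sub, coeff_sub, finsetSum_coeff, coeff_mul_C,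
    mul_left_comm _ X, coeff_X_mul_zero]
  simp

theorem coeff_pencil_mul (H K : Matrix (Fin n) (Fin n) F) (G : Matrix (Fin n) (Fin n) F[X])
    (i : ℕ) : (pencil H K * G).map (fun f => f.coeff (i + 1)) =
      K * G.map (fun f => f.coeff (i + 1)) - H * G.map (fun f => f.coeff i) := by
  ext a b
  simp only [pencil, Matrix.map_apply, Matrix.mul_apply, Matrix.sub_apply, Matrix.smul_apply,
    smul_eq_mul, sub_mul, coeff_sub, finsetSum_coeff, coeff_C_mul,
    mul_assoc, coeff_X_mul]

theorem coeff_zero_pencil_mul (H K : Matrix (Fin n) (Fin n) F) (G : Matrix (Fin n) (Fin n) F[X]) :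
    (pencil H K * G).map (fun f => f.coeff 0) = K * G.map (fun f => f.coeff 0) := by
  ext a b
  simp only [pencil, Matrix.map_apply, Matrix.mul_apply, Matrix.sub_apply, Matrix.smul_apply,
    smul_eq_mul, sub_mul, coeff_sub, finsetSum_coeff, coeff_C_mul,
    mul_assoc, coeff_X_mul_zero]
  simp

/-- `A 0 + A 1 x + ⋯` is, up to order `ρ`, a two-sided inverse of `K - xH` times `c x ^ ρ`. -/
structure IsLocalInverse (H K : Matrix (Fin n) (Fin n) F) (c : F) (ρ : ℕ)
    (A : ℕ → Matrix (Fin n) (Fin n) F) : Prop where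
  left_zero : A 0 * K = if ρ = 0 then c • 1 else 0
  left_succ : ∀ i < ρ, A (i + 1) * K - A i * H = if i + 1 = ρ then c • 1 else 0
  right_zero : K * A 0 = if ρ = 0 then c • 1 else 0
  right_succ : ∀ i < ρ, K * A (i + 1) - H * A i = if i + 1 = ρ then c • 1 else 0

theorem exists_isLocalInverse (H K : Matrix (Fin n) (Fin n) F) (h : (pencil H K).det ≠ 0) :
    ∃ (c : F) (ρ : ℕ) (A : ℕ → Matrix (Fin n) (Fin n) F), c ≠ 0 ∧ IsLocalInverse H K c ρ A := by
  set d := (pencil H K).det with hd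
  have hco : ∀ i ≤ d.natTrailingDegree,
      (d • (1 : Matrix (Fin n) (Fin n) F[X])).map (fun f => f.coeff i) =
        if i = d.natTrailingDegree then d.trailingCoeff • 1 else 0 := by
    intro i hi
    ext a b
    simp only [Matrix.map_apply, Matrix.smul_apply, smul_eq_mul, Matrix.one_apply, mul_ite,
      mul_one, mul_zero]
    by_cases hab : a = b
    · subst hab
      simp only [if_true]
      split_ifs with h'
      · simp [h', trailingCoeff]
      · simpa using coeff_eq_zero_of_lt_natTrailingDegree (lt_of_le_of_ne hi h')
    · split_ifs with h' <;> simp [hab]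
  refine ⟨d.trailingCoeff, d.natTrailingDegree,
    fun i => (pencil H K).adjugate.map (fun f => f.coeff i),
    by simpa [trailingCoeff_eq_zero] using h, ?_, ?_, ?_, ?_⟩
  · rw [← coeff_zero_mul_pencil, adjugate_mul, hco 0 (Nat.zero_le _)]
    simp only [eq_comm]
  · intro i hi
    rw [← coeff_mul_pencil, adjugate_mul, hco _ hi]
  · rw [← coeff_zero_pencil_mul, mul_adjugate, hco 0 (Nat.zero_le _)]
    simp only [eq_comm]
  · intro i hi
    rw [← coeff_pencil_mul, mul_adjugate, hco _ hi]

theorem IsLocalInverse.tail {H K : Matrix (Fin n) (Fin n) F} {c : F} {ρ : ℕ}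
    {A : ℕ → Matrix (Fin n) (Fin n) F} (h : IsLocalInverse H K c (ρ + 1) A) (h0 : A 0 = 0) :
    IsLocalInverse H K c ρ fun i => A (i + 1) where
  left_zero := by
    have := h.left_succ 0 (Nat.succ_pos _)
    rw [h0, Matrix.zero_mul, sub_zero] at this
    rw [this]
    simp
  left_succ i hi := by simpa using h.left_succ (i + 1) (by omega)
  right_zero := by
    have := h.right_succ 0 (Nat.succ_pos _)
    rw [h0, Matrix.mul_zero, sub_zero] at this
    rw [this]
    simp
  right_succ i hi := by simpa using h.right_succ (i + 1) (by omega)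

theorem IsLocalInverse.exists_hasShiftBlock {H K : Matrix (Fin n) (Fin n) F} {c : F} {ρ : ℕ}
    {A : ℕ → Matrix (Fin n) (Fin n) F} (h : IsLocalInverse H K c ρ A) (hc : c ≠ 0)
    (hK : K.det = 0) (h0 : A 0 ≠ 0) : ∃ r, 0 < r ∧ HasShiftBlock H K r := by
  rcases ρ with _ | ρ
  · exfalso
    have h1 := congr_arg Matrix.det h.left_zero
    rw [if_pos rfl, Matrix.det_mul, hK, mul_zero, Matrix.det_smul, Matrix.det_one, mul_one] at h1
    exact pow_ne_zero _ hc h1.symm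
  obtain ⟨a, b, hab⟩ : ∃ a b, A 0 a b ≠ 0 := by
    by_contra! hcon
    exact h0 (Matrix.ext hcon)
  refine ⟨ρ + 1, Nat.succ_pos _, hasShiftBlock_of_chains (X := of fun i j => A (ρ - i) a j)
    (Y := of fun i j => A j i b) ?_ ?_ (Nat.succ_pos _) ?_⟩
  · ext i j
    rw [mul_shift_apply]
    obtain ⟨j, hj⟩ := j
    rcases j with _ | j
    · simpa [Matrix.mul_apply] using congr_fun (congr_fun h.right_zero i) b
    · have := congr_fun (congr_fun (h.right_succ j (by omega)) i) b
      rw [if_neg (by omega), Matrix.sub_apply, Matrix.zero_apply, sub_eq_zero] at this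
      simpa [Matrix.mul_apply] using this
  · ext i j
    rw [shift_mul_apply]
    obtain ⟨i, hi⟩ := i
    split_ifs with hlt
    · simp only at hlt
      have := congr_fun (congr_fun (h.left_succ (ρ - (i + 1)) (by omega)) a) j
      rw [if_neg (by omega), Matrix.sub_apply, Matrix.zero_apply, sub_eq_zero,
        show ρ - (i + 1) + 1 = ρ - i by omega] at this
      simpa [Matrix.mul_apply] using this
    · simp only at hlt
      have := congr_fun (congr_fun h.left_zero a) j
      rw [if_neg (by omega)] at this
      simpa [Matrix.mul_apply, show ρ - i = 0 by omega] using this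
  · have h1 : A ρ * H * A 0 = -(c • A 0) := by
      have h2 := h.left_succ ρ (Nat.lt_succ_self _)
      rw [if_pos rfl] at h2
      have h3 := h.right_zero
      rw [if_neg (Nat.succ_ne_zero _)] at h3
      have h4 : A ρ * H = A (ρ + 1) * K - c • 1 := by rw [← h2]; abel
      rw [h4, Matrix.sub_mul, Matrix.mul_assoc, h3]
      simp
    have h5 := congr_fun (congr_fun h1 a) b
    have h6 : ((of fun (i : Fin (ρ + 1)) j => A (ρ - i) a j) * H *
        (of fun i (j : Fin (ρ + 1)) => A j i b)) ⟨0, Nat.succ_pos _⟩ ⟨0, Nat.succ_pos _⟩ =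
        (A ρ * H * A 0) a b := by
      simp [Matrix.mul_apply]
    rw [h6, h5]
    simpa using ⟨hc, hab⟩

theorem exists_hasShiftBlock {H K : Matrix (Fin n) (Fin n) F} (h : (pencil H K).det ≠ 0)
    (hK : K.det = 0) : ∃ r, 0 < r ∧ HasShiftBlock H K r := by
  obtain ⟨c, ρ, A, hc, hA⟩ := exists_isLocalInverse H K h
  induction ρ generalizing A with
  | zero =>
    refine hA.exists_hasShiftBlock hc hK fun h0 => ?_
    have h1 := congr_arg Matrix.det hA.left_zero
    rw [if_pos rfl, Matrix.det_mul, hK, mul_zero, Matrix.det_smul, Matrix.det_one, mul_one] at h1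
    exact pow_ne_zero _ hc h1.symm
  | succ ρ ih =>
    by_cases h0 : A 0 = 0
    · exact ih _ (hA.tail h0)
    · exact hA.exists_hasShiftBlock hc hK h0

end ShiftBlocks

section OddBlocks

variable {n r : ℕ}

theorem det_pencil_shift (r : ℕ) :
    ((shift F r).map C - (X : F[X]) • (1 : Matrix (Fin r) (Fin r) F[X])).det = (-X) ^ r := by
  have hup :
      ((shift F r).map C - (X : F[X]) • (1 : Matrix (Fin r) (Fin r) F[X])).IsUpperTriangular := by
    intro i j h
    have h' : (j : ℕ) < i := h
    rw [Matrix.sub_apply, Matrix.map_apply, shift_apply, if_neg (by omega), Matrix.smul_apply,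
      Matrix.one_apply_ne (by rintro rfl; omega)]
    simp
  rw [Matrix.det_of_isUpperTriangular hup]
  simp [shift_apply]

theorem coeff_zero_det_pencil (H K : Matrix (Fin n) (Fin n) F) :
    (pencil H K).det.coeff 0 = K.det := by
  rw [coeff_zero_eq_eval_zero, ← coe_evalRingHom, RingHom.map_det]
  congr 1
  ext i j
  simp [pencil]

/-- Splitting off a block `(1, shift r)` lowers the order of vanishing of `det (K - xH)` at `0`
by `r`, and the blocks of the complementary pair are blocks of the given pair. -/
theorem HasShiftBlock.exists_complement {H K : Matrix (Fin n) (Fin n) F}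
    (h : HasShiftBlock H K r) (hP : (pencil H K).det ≠ 0) :
    ∃ (c : ℕ) (_ : r + c = n) (H' K' : Matrix (Fin c) (Fin c) F), (pencil H' K').det ≠ 0 ∧
      (pencil H K).det.natTrailingDegree = r + (pencil H' K').det.natTrailingDegree ∧
      ∀ s, HasShiftBlock H' K' s → HasShiftBlock H K s := by
  obtain ⟨Z, Y, h1, hY, hZ⟩ := h
  obtain ⟨c, hc, Y', p', a1, a2, a3, a4⟩ := _root_.exists_complement h1
  obtain ⟨c', hc', q', Z', b1, b2, b3, b4⟩ :=
    _root_.exists_complement (p := Z) (Y := H * Y) (by rw [← Matrix.mul_assoc, h1])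
  obtain rfl : c = c' := by omega
  have hR : fromRows Z Z' * fromCols (H * Y) q' = 1 := by
    rw [fromRows_mul_fromCols, ← Matrix.mul_assoc Z, h1, b1, b2, b3, fromBlocks_one]
  have hR' : fromCols (H * Y) q' * fromRows Z Z' = 1 := by
    rw [fromCols_mul_fromRows, b4]
  have hS : fromCols Y Y' * fromRows (Z * H) p' = 1 := by
    rw [fromCols_mul_fromRows, a4]
  have hH : fromRows Z Z' * H * fromCols Y Y' = fromBlocks 1 0 0 (Z' * H * Y') := by
    rw [fromRows_mul, fromRows_mul_fromCols, h1, a1, Matrix.mul_assoc, b2]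
  have hKY : Z' * K * Y = 0 := by
    rw [Matrix.mul_assoc, hY, ← Matrix.mul_assoc, b2, Matrix.zero_mul]
  have hK : fromRows Z Z' * K * fromCols Y Y' = fromBlocks (shift F r) 0 0 (Z' * K * Y') := by
    rw [fromRows_mul, fromRows_mul_fromCols, hZ, Matrix.mul_assoc (shift F r) (Z * H) Y, h1,
      Matrix.mul_assoc (shift F r) (Z * H) Y', a1, hKY, Matrix.mul_one, Matrix.mul_zero]
  have hpen : (fromRows Z Z').map C * (pencil H K * (fromCols Y Y').map C) =
      fromBlocks ((shift F r).map C - (X : F[X]) • (1 : Matrix (Fin r) (Fin r) F[X])) 0 0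
        (pencil (Z' * H * Y') (Z' * K * Y')) := by
    have e1 : (fromRows Z Z').map C * (pencil H K * (fromCols Y Y').map C) =
        (fromRows Z Z' * K * fromCols Y Y').map C -
          (X : F[X]) • (fromRows Z Z' * H * fromCols Y Y').map C := by
      rw [pencil, Matrix.sub_mul, Matrix.mul_sub, Matrix.smul_mul, Matrix.mul_smul]
      simp only [Matrix.map_mul, Matrix.mul_assoc]
    rw [e1, hH, hK, fromBlocks_map, fromBlocks_map, fromBlocks_smul, sub_eq_add_neg,
      fromBlocks_neg, fromBlocks_add, pencil]
    simp [sub_eq_add_neg]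
  have hu : (fromCols Y Y' * fromRows Z Z').det ≠ 0 := by
    refine Matrix.det_ne_zero_of_right_inverse (B := fromCols (H * Y) q' * fromRows (Z * H) p') ?_
    rw [Matrix.mul_assoc, ← Matrix.mul_assoc (fromRows Z Z'), hR, Matrix.one_mul, hS]
  have hdet : (pencil H K).det * C (fromCols Y Y' * fromRows Z Z').det =
      (-X) ^ r * (pencil (Z' * H * Y') (Z' * K * Y')).det := by
    rw [← det_pencil_shift, ← Matrix.det_fromBlocks_zero₂₁, ← hpen,
      Matrix.det_comm' (M' := (fromCols (H * Y) q').map C)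
        (by rw [← Matrix.map_mul, hR]; simp) (by rw [← Matrix.map_mul, hR']; simp),
      Matrix.mul_assoc, ← Matrix.map_mul, Matrix.det_mul, RingHom.map_det]
    rfl
  have hne : (pencil (Z' * H * Y') (Z' * K * Y')).det ≠ 0 := by
    intro h0
    rw [h0, mul_zero] at hdet
    exact mul_ne_zero hP (C_ne_zero.2 hu) hdet
  refine ⟨c, hc, Z' * H * Y', Z' * K * Y', hne, ?_, ?_⟩
  · have := congr_arg natTrailingDegree hdet
    rw [natTrailingDegree_mul hP (C_ne_zero.2 hu), natTrailingDegree_C, add_zero,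
      natTrailingDegree_mul (pow_ne_zero _ (neg_ne_zero.2 X_ne_zero)) hne, neg_pow] at this
    rw [this]
    congr 1
    rcases neg_one_pow_eq_or F[X] r with h' | h' <;> rw [h'] <;> simp
  · rintro s ⟨U, V, k1, k2, k3⟩
    refine ⟨U * Z', Y' * V, ?_, ?_, ?_⟩
    · rw [← k1]
      simp only [Matrix.mul_assoc]
    · have hKY' : Z * K * Y' = 0 := by
        rw [hZ, Matrix.mul_assoc, a1, Matrix.mul_zero]
      have l1 : K * Y' = q' * (Z' * K * Y') := by
        calc K * Y' = (H * Y * Z + q' * Z') * (K * Y') := by rw [b4, Matrix.one_mul]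
          _ = H * Y * (Z * K * Y') + q' * (Z' * K * Y') := by
            simp only [Matrix.add_mul, Matrix.mul_assoc]
          _ = _ := by rw [hKY', Matrix.mul_zero, zero_add]
      have l2 : H * Y' = q' * (Z' * H * Y') := by
        calc H * Y' = (H * Y * Z + q' * Z') * (H * Y') := by rw [b4, Matrix.one_mul]
          _ = H * Y * (Z * H * Y') + q' * (Z' * H * Y') := by
            simp only [Matrix.add_mul, Matrix.mul_assoc]
          _ = _ := by rw [a1, Matrix.mul_zero, zero_add]
      rw [← Matrix.mul_assoc, l1, Matrix.mul_assoc, k2, ← Matrix.mul_assoc H, l2]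
      simp only [Matrix.mul_assoc]
    · have l1 : Z' * K = Z' * K * Y' * p' := by
        calc Z' * K = Z' * K * (Y * (Z * H) + Y' * p') := by rw [a4, Matrix.mul_one]
          _ = Z' * K * Y * (Z * H) + Z' * K * Y' * p' := by
            simp only [Matrix.mul_add, Matrix.mul_assoc]
          _ = _ := by rw [hKY, Matrix.zero_mul, zero_add]
      have l2 : Z' * H = Z' * H * Y' * p' := by
        calc Z' * H = Z' * H * (Y * (Z * H) + Y' * p') := by rw [a4, Matrix.mul_one]
          _ = Z' * (H * Y) * (Z * H) + Z' * H * Y' * p' := by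
            simp only [Matrix.mul_add, Matrix.mul_assoc]
          _ = _ := by rw [b2, Matrix.zero_mul, zero_add]
      calc U * Z' * K = U * (Z' * K * Y') * p' := by
            rw [Matrix.mul_assoc U, Matrix.mul_assoc U, ← l1]
        _ = shift F s * (U * (Z' * H * Y' * p')) := by
            rw [k3]
            simp only [Matrix.mul_assoc]
        _ = _ := by rw [← l2, Matrix.mul_assoc U]

theorem exists_odd_hasShiftBlock {H K : Matrix (Fin n) (Fin n) F} (hP : (pencil H K).det ≠ 0)
    (hodd : Odd (pencil H K).det.natTrailingDegree) : ∃ r, Odd r ∧ HasShiftBlock H K r := by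
  induction n using Nat.strong_induction_on with
  | _ n ih =>
    have hK : K.det = 0 := by
      rw [← coeff_zero_det_pencil H K]
      exact coeff_eq_zero_of_lt_natTrailingDegree hodd.pos
    obtain ⟨r, hr, hb⟩ := exists_hasShiftBlock hP hK
    rcases Nat.even_or_odd r with he | ho
    · obtain ⟨c, hc, H', K', hP', hdeg, hlift⟩ := hb.exists_complement hP
      have hodd' : Odd (pencil H' K').det.natTrailingDegree := by
        rw [hdeg, Nat.odd_add'] at hodd
        exact hodd.2 he
      obtain ⟨s, hs, hs'⟩ := ih c (by omega) hP' hodd'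
      exact ⟨s, hs, hlift s hs'⟩
    · exact ⟨r, ho, hb⟩

theorem pencil_neg (M : Matrix (Fin n) (Fin n) F) :
    (pencil (M + Mᵀ) (M - Mᵀ)).map (compRingHom (-X)) = -(pencil (M + Mᵀ) (M - Mᵀ))ᵀ := by
  ext1 i j
  simp [pencil]
  ring

theorem odd_natTrailingDegree_det_pencil (hchar : (2 : F) ≠ 0) (hn : Odd n)
    {M : Matrix (Fin n) (Fin n) F} (hP : (pencil (M + Mᵀ) (M - Mᵀ)).det ≠ 0) :
    Odd (pencil (M + Mᵀ) (M - Mᵀ)).det.natTrailingDegree := by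
  set d := (pencil (M + Mᵀ) (M - Mᵀ)).det with hd
  have h1 : d.comp (-X) = -d := by
    have := RingHom.map_det (compRingHom (-X : F[X])) (pencil (M + Mᵀ) (M - Mᵀ))
    rw [RingHom.mapMatrix_apply, pencil_neg, Matrix.det_neg, Matrix.det_transpose,
      Fintype.card_fin, hn.neg_one_pow, neg_one_mul] at this
    simpa using this
  by_contra hcon
  have h2 : (d.comp (-X)).coeff d.natTrailingDegree = (-d).coeff d.natTrailingDegree := by rw [h1]
  rw [show (-X : F[X]) = C (-1) * X by simp, comp_C_mul_X_coeff,
    (Nat.not_odd_iff_even.1 hcon).neg_one_pow, mul_one, coeff_neg] at h2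
  have h3 : d.trailingCoeff ≠ 0 := by simpa [trailingCoeff_eq_zero] using hP
  have h4 : (2 : F) * d.trailingCoeff = 0 := by
    rw [trailingCoeff]
    linear_combination h2
  exact (mul_ne_zero hchar h3) h4

end OddBlocks

section GamBlocks

variable {n r : ℕ}

/-- The antidiagonal `r × r` matrix with alternating signs. -/
def altAnti (F : Type*) [Field F] (r : ℕ) : Matrix (Fin r) (Fin r) F :=
  of fun i j => if (i : ℕ) + j + 1 = r then (-1) ^ (i : ℕ) else 0

theorem altAnti_mul_self (hr : Odd r) : altAnti F r * altAnti F r = 1 := by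
  ext i j
  have hi := i.2
  rw [Matrix.mul_apply, Finset.sum_eq_single ⟨r - 1 - i, by omega⟩]
  · simp only [altAnti, of_apply, Matrix.one_apply]
    rw [if_pos (by omega)]
    by_cases hij : i = j
    · rw [if_pos hij, if_pos (by omega), ← pow_add, show (i : ℕ) + (r - 1 - i) = r - 1 by omega]
      obtain ⟨k, rfl⟩ := hr
      simp
    · rw [if_neg hij, if_neg (fun h => hij (Fin.ext (by omega))), mul_zero]
  · intro b _ hb
    simp only [altAnti, of_apply]
    rw [if_neg (fun h => hb (Fin.ext (by simp only; omega))), zero_mul]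
  · simp

theorem transpose_altAnti (hr : Odd r) : (altAnti F r)ᵀ = altAnti F r := by
  ext i j
  simp only [altAnti, transpose_apply, of_apply]
  by_cases h : (i : ℕ) + j + 1 = r
  · rw [if_pos h, if_pos (by omega)]
    obtain ⟨k, rfl⟩ := hr
    have he : Even ((i : ℕ) + j) := ⟨k, by omega⟩
    rcases Nat.even_or_odd (i : ℕ) with hi | hi
    · rw [hi.neg_one_pow, ((Nat.even_add.1 he).1 hi).neg_one_pow]
    · rw [hi.neg_one_pow, ((Nat.even_add'.1 he).1 hi).neg_one_pow]
  · rw [if_neg h, if_neg (by omega)]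

theorem altAnti_mul_shift_apply (i j : Fin r) :
    (altAnti F r * shift F r) i j = if (i : ℕ) + j = r then (-1) ^ (i : ℕ) else 0 := by
  have hi := i.2
  rw [mul_shift_apply]
  simp only [altAnti, of_apply]
  split_ifs <;> first | rfl | omega

theorem transpose_shift_mul_altAnti (hr : Odd r) :
    (shift F r)ᵀ * altAnti F r = -(altAnti F r * shift F r) := by
  rw [← transpose_altAnti hr, ← Matrix.transpose_mul, transpose_altAnti hr]
  ext i j
  rw [transpose_apply, Matrix.neg_apply, altAnti_mul_shift_apply, altAnti_mul_shift_apply]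
  by_cases h : (i : ℕ) + j = r
  · rw [if_pos h, if_pos (by omega)]
    rw [← h] at hr
    rcases Nat.even_or_odd (i : ℕ) with hi | hi
    · rw [hi.neg_one_pow, ((Nat.odd_add'.1 hr).2 hi).neg_one_pow]
    · rw [hi.neg_one_pow, ((Nat.odd_add.1 hr).1 hi).neg_one_pow, neg_neg]
  · rw [if_neg h, if_neg (by omega), neg_zero]

theorem altAnti_mul_transpose_shift (hr : Odd r) :
    altAnti F r * (shift F r)ᵀ = -(shift F r * altAnti F r) := by
  have h' := congr_arg (fun D => altAnti F r * D * altAnti F r)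
    (transpose_shift_mul_altAnti (F := F) hr)
  simp only [Matrix.mul_neg, Matrix.neg_mul] at h'
  rw [← Matrix.mul_assoc (altAnti F r) (altAnti F r), altAnti_mul_self hr, Matrix.one_mul,
    ← Matrix.mul_assoc, Matrix.mul_assoc _ (altAnti F r), altAnti_mul_self hr, Matrix.mul_one] at h'
  exact h'

theorem gam_eq (hr : Odd r) : (Gam r : Matrix (Fin r) (Fin r) F) =
    altAnti F r + altAnti F r * shift F r := by
  ext i j
  have hi := i.2
  rw [Matrix.add_apply, altAnti_mul_shift_apply]
  simp only [Gam, altAnti, of_apply]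
  have hs : (-1 : F) ^ (r - 1 - (i : ℕ)) = (-1) ^ (i : ℕ) := by
    have h1 : (-1 : F) ^ (r - 1 - (i : ℕ)) * (-1) ^ (i : ℕ) = 1 := by
      rw [← pow_add, show r - 1 - (i : ℕ) + i = r - 1 by omega]
      obtain ⟨k, rfl⟩ := hr
      simp
    rcases neg_one_pow_eq_or F (i : ℕ) with h | h <;> rw [h] at h1 ⊢
    · simpa using h1
    · linear_combination -h1
  rw [hs]
  split_ifs <;> first | omega | simp

theorem gam_transpose_eq (hr : Odd r) : (Gam r : Matrix (Fin r) (Fin r) F)ᵀ =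
    altAnti F r - altAnti F r * shift F r := by
  rw [gam_eq hr, Matrix.transpose_add, Matrix.transpose_mul, transpose_altAnti hr,
    transpose_shift_mul_altAnti hr, sub_eq_add_neg]

theorem HasShiftBlock.pairSummand_gam (hchar : (2 : F) ≠ 0) {M : Matrix (Fin n) (Fin n) F}
    (hr : Odd r) (h : HasShiftBlock (M + Mᵀ) (M - Mᵀ) r) :
    PairSummand Mᵀ M (Gam r : Matrix (Fin r) (Fin r) F)ᵀ (Gam r) := by
  obtain ⟨X, Y, h1, hY, hX⟩ := h
  have e1 : (2 : F) • M = (M + Mᵀ) + (M - Mᵀ) := by rw [two_smul]; abel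
  have e2 : (2 : F) • Mᵀ = (M + Mᵀ) - (M - Mᵀ) := by rw [two_smul]; abel
  have hh : (2 : F)⁻¹ * 2 = 1 := inv_mul_cancel₀ hchar
  set H := M + Mᵀ with hH
  set K := M - Mᵀ with hK
  have f1 : M = (2 : F)⁻¹ • (H + K) := by rw [← e1, smul_smul, hh, one_smul]
  have f2 : Mᵀ = (2 : F)⁻¹ • (H - K) := by rw [← e2, smul_smul, hh, one_smul]
  have hq : (altAnti F r * X) * (H * Y * altAnti F r) = 1 := by
    rw [Matrix.mul_assoc, ← Matrix.mul_assoc X, ← Matrix.mul_assoc X, h1, Matrix.one_mul,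
      altAnti_mul_self hr]
  rw [gam_transpose_eq hr, gam_eq hr]
  have a2 := altAnti_mul_self (F := F) hr
  refine pairSummand_of_split (X := (2 : F) • (altAnti F r * X)) (p := X * H) (Y := Y)
    (q := (2 : F)⁻¹ • (H * Y * altAnti F r)) h1 ?_ ?_ ?_ ?_ ?_
  · rw [Matrix.smul_mul, Matrix.mul_smul, hq, smul_smul, mul_comm, hh, one_smul]
  · rw [Matrix.smul_mul, ← Matrix.mul_smul, e2, Matrix.mul_sub, Matrix.mul_assoc _ X K, hX,
      Matrix.sub_mul]
    simp only [Matrix.mul_assoc]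
  · rw [Matrix.smul_mul, ← Matrix.mul_smul, e1, Matrix.mul_add, Matrix.mul_assoc _ X K, hX,
      Matrix.add_mul]
    simp only [Matrix.mul_assoc]
  · rw [f2, Matrix.smul_mul, Matrix.smul_mul, Matrix.sub_mul, hY, Matrix.mul_sub,
      ← Matrix.mul_assoc _ (altAnti F r), Matrix.mul_assoc _ (altAnti F r), a2, Matrix.mul_one]
  · rw [f1, Matrix.smul_mul, Matrix.smul_mul, Matrix.add_mul, hY, Matrix.mul_add,
      ← Matrix.mul_assoc _ (altAnti F r), Matrix.mul_assoc _ (altAnti F r), a2, Matrix.mul_one]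

theorem PairSummand.hasShiftBlock (hchar : (2 : F) ≠ 0) {M : Matrix (Fin n) (Fin n) F}
    (hr : Odd r) (h : PairSummand Mᵀ M (Gam r : Matrix (Fin r) (Fin r) F)ᵀ (Gam r)) :
    HasShiftBlock (M + Mᵀ) (M - Mᵀ) r := by
  obtain ⟨X, p, Y, q, hp, -, l1, l2, r1, r2⟩ := h.exists_split
  rw [gam_transpose_eq hr] at l1 r1
  rw [gam_eq hr] at l2 r2
  have a2 := altAnti_mul_self (F := F) hr
  have hh : (2 : F)⁻¹ * 2 = 1 := inv_mul_cancel₀ hchar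
  have m1 : X * (M + Mᵀ) = (2 : F) • (altAnti F r * p) := by
    rw [Matrix.mul_add, l1, l2, Matrix.add_mul, Matrix.sub_mul, two_smul]; abel
  have m2 : X * (M - Mᵀ) = (2 : F) • (altAnti F r * shift F r * p) := by
    rw [Matrix.mul_sub, l1, l2, Matrix.add_mul, Matrix.sub_mul, two_smul]; abel
  have n1 : (M + Mᵀ) * Y = (2 : F) • (q * altAnti F r) := by
    rw [Matrix.add_mul, r1, r2, Matrix.mul_add, Matrix.mul_sub, two_smul]; abel
  have n2 : (M - Mᵀ) * Y = (2 : F) • (q * (altAnti F r * shift F r)) := by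
    rw [Matrix.sub_mul, r1, r2, Matrix.mul_add, Matrix.mul_sub, two_smul]; abel
  have hXH : (2 : F)⁻¹ • (altAnti F r * X) * (M + Mᵀ) = p := by
    rw [Matrix.smul_mul, Matrix.mul_assoc, m1, Matrix.mul_smul, smul_smul, hh, one_smul,
      ← Matrix.mul_assoc, a2, Matrix.one_mul]
  refine ⟨(2 : F)⁻¹ • (altAnti F r * X), Y, ?_, ?_, ?_⟩
  · rw [hXH, hp]
  · rw [n1, n2, Matrix.smul_mul, Matrix.mul_assoc]
  · rw [hXH, Matrix.smul_mul, Matrix.mul_assoc, m2, Matrix.mul_smul, smul_smul, hh, one_smul,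
      ← Matrix.mul_assoc, ← Matrix.mul_assoc, a2, Matrix.one_mul]

theorem HasShiftBlock.exists_nondegenerate (hchar : (2 : F) ≠ 0) {H K : Matrix (Fin n) (Fin n) F}
    (hH : Hᵀ = H) (hK : Kᵀ = -K) (hr : Odd r) (h : HasShiftBlock H K r) :
    ∃ Z : Matrix (Fin n) (Fin r) F, K * Z = H * Z * shift F r ∧ IsUnit (Zᵀ * H * Z).det := by
  obtain ⟨X, Y, h1, hY, hX⟩ := h
  have a2 := altAnti_mul_self (F := F) hr
  have at' := transpose_altAnti (F := F) hr
  have hunit : ∀ Z : Matrix (Fin n) (Fin r) F, K * Z = H * Z * shift F r →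
      (altAnti F r * Zᵀ * H * Z) ⟨0, hr.pos⟩ ⟨0, hr.pos⟩ ≠ 0 → IsUnit (Zᵀ * H * Z).det := by
    intro Z hZ h0
    have hZ' : altAnti F r * Zᵀ * K = shift F r * (altAnti F r * Zᵀ * H) := by
      have := congr_arg transpose hZ
      rw [Matrix.transpose_mul, Matrix.transpose_mul, Matrix.transpose_mul, hH, hK,
        Matrix.mul_neg, neg_eq_iff_eq_neg] at this
      rw [Matrix.mul_assoc, this, Matrix.mul_neg, ← Matrix.mul_assoc,
        altAnti_mul_transpose_shift hr, Matrix.neg_mul, neg_neg]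
      simp only [Matrix.mul_assoc]
    have := isUnit_det_of_commute_shift hr.pos (commute_shift_of_chains hZ hZ') h0
    rw [Matrix.mul_assoc, Matrix.mul_assoc, Matrix.det_mul, ← Matrix.mul_assoc] at this
    exact isUnit_of_mul_isUnit_right this
  have hX' : K * (Xᵀ * altAnti F r) = H * (Xᵀ * altAnti F r) * shift F r := by
    have := congr_arg transpose hX
    rw [Matrix.transpose_mul, Matrix.transpose_mul, Matrix.transpose_mul, hH, hK,
      Matrix.neg_mul, neg_eq_iff_eq_neg] at this
    rw [← Matrix.mul_assoc, this, Matrix.neg_mul, Matrix.mul_assoc,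
      transpose_shift_mul_altAnti hr, Matrix.mul_neg, neg_neg]
    simp only [Matrix.mul_assoc]
  set Z := Xᵀ * altAnti F r with hZ
  have hsum : altAnti F r * (Y + Z)ᵀ * H * (Y + Z) =
      altAnti F r * Yᵀ * H * Y + altAnti F r * Zᵀ * H * Z + 1 + 1 := by
    have c1 : altAnti F r * Zᵀ * H * Y = 1 := by
      rw [hZ, Matrix.transpose_mul, at', Matrix.transpose_transpose, ← Matrix.mul_assoc, a2,
        Matrix.one_mul, h1]
    have c2 : altAnti F r * Yᵀ * H * Z = 1 := by
      have := congr_arg transpose h1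
      rw [Matrix.transpose_mul, Matrix.transpose_mul, hH, Matrix.transpose_one] at this
      rw [hZ, Matrix.mul_assoc, Matrix.mul_assoc, ← Matrix.mul_assoc H, ← Matrix.mul_assoc Yᵀ,
        this, Matrix.one_mul, a2]
    rw [Matrix.transpose_add]
    simp only [Matrix.mul_add, Matrix.add_mul]
    rw [c1, c2]
    abel
  by_cases hc1 : (altAnti F r * Yᵀ * H * Y) ⟨0, hr.pos⟩ ⟨0, hr.pos⟩ = 0
  · by_cases hc2 : (altAnti F r * Zᵀ * H * Z) ⟨0, hr.pos⟩ ⟨0, hr.pos⟩ = 0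
    · refine ⟨Y + Z, ?_, hunit _ ?_ ?_⟩
      · rw [Matrix.mul_add, hY, hX', Matrix.mul_add, Matrix.add_mul]
      · rw [Matrix.mul_add, hY, hX', Matrix.mul_add, Matrix.add_mul]
      · rw [hsum]
        simp only [Matrix.add_apply, hc1, hc2, Matrix.one_apply_eq]
        intro h
        exact hchar (by linear_combination h)
    · exact ⟨Z, hX', hunit _ hX' hc2⟩
  · exact ⟨Y, hY, hunit _ hY hc1⟩

theorem HasShiftBlock.not_xiMem (hchar : (2 : F) ≠ 0) {M : Matrix (Fin n) (Fin n) F}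
    (hr : Odd r) (h : HasShiftBlock (M + Mᵀ) (M - Mᵀ) r) : ¬ XiMem M := by
  have hH : (M + Mᵀ)ᵀ = M + Mᵀ := by
    rw [Matrix.transpose_add, Matrix.transpose_transpose, add_comm]
  have hK : (M - Mᵀ)ᵀ = -(M - Mᵀ) := by
    rw [Matrix.transpose_sub, Matrix.transpose_transpose, neg_sub]
  obtain ⟨Z, hZ, hu⟩ := h.exists_nondegenerate hchar hH hK hr
  have e1 : M = (2 : F)⁻¹ • ((M + Mᵀ) + (M - Mᵀ)) := by
    rw [add_add_sub_cancel, ← two_smul F, smul_smul, inv_mul_cancel₀ hchar, one_smul]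
  have e2 : Mᵀ = (2 : F)⁻¹ • ((M + Mᵀ) - (M - Mᵀ)) := by
    rw [add_sub_sub_cancel, ← two_smul F, smul_smul, inv_mul_cancel₀ hchar, one_smul]
  set H := M + Mᵀ
  set K := M - Mᵀ
  clear_value H K
  set A := Zᵀ * H * Z with hA
  have hAt : Aᵀ = A := by
    rw [hA, Matrix.transpose_mul, Matrix.transpose_mul, hH, Matrix.transpose_transpose,
      Matrix.mul_assoc]
  set p := A⁻¹ * (Zᵀ * H) with hp
  have hpt : pᵀ = H * Z * A⁻¹ := by
    rw [hp, Matrix.transpose_mul, Matrix.transpose_nonsing_inv, hAt, Matrix.transpose_mul, hH,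
      Matrix.transpose_transpose]
  have c1 : H * Z = pᵀ * (Zᵀ * H * Z) := by
    rw [hpt, ← hA, Matrix.nonsing_inv_mul_cancel_right _ _ hu]
  have c2 : K * Z = pᵀ * (Zᵀ * K * Z) := by
    rw [Matrix.mul_assoc Zᵀ, hZ, ← Matrix.mul_assoc Zᵀ, ← Matrix.mul_assoc Zᵀ,
      ← Matrix.mul_assoc pᵀ, ← c1]
  have c3 : M * Z = pᵀ * (Zᵀ * M * Z) := by
    rw [e1, Matrix.smul_mul, Matrix.mul_smul, Matrix.smul_mul,
      Matrix.mul_smul, Matrix.mul_add _ H K,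
      Matrix.add_mul H K, Matrix.add_mul _ _ Z, Matrix.mul_add, ← c1, ← c2]
  have c4 : Mᵀ * Z = pᵀ * (Zᵀ * Mᵀ * Z) := by
    rw [e2, Matrix.smul_mul, Matrix.mul_smul, Matrix.smul_mul,
      Matrix.mul_smul, Matrix.mul_sub _ H K,
      Matrix.sub_mul H K, Matrix.sub_mul _ _ Z, Matrix.mul_sub, ← c1, ← c2]
  refine not_xiMem_of_split hchar hr (p := p) (Y := Z) (A := Zᵀ * M * Z) ?_ ?_ c3
  · rw [hp, Matrix.mul_assoc, ← hA, Matrix.nonsing_inv_mul _ hu]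
  · have := congr_arg transpose c4
    simpa [Matrix.transpose_mul, Matrix.mul_assoc] using this

end GamBlocks

section Chains

variable {V : Type*} [AddCommGroup V] [Module F V]

/-- Vectors of `W` whose alternating images under the two adjoints of `B` match up, starting in
the left radical and ending in the right radical of `B` on `W`. -/
structure IsRadicalChain (B : V →ₗ[F] V →ₗ[F] F) (W : Submodule F V) (k : ℕ) (v : ℕ → V) :
    Prop where
  ne : v 0 ≠ 0
  mem : ∀ i ≤ k, v i ∈ W
  left : ∀ w ∈ W, B (v 0) w = 0
  step : ∀ i < k, ∀ w ∈ W, B w (v i) = B (v (i + 1)) w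
  right : ∀ w ∈ W, B w (v k) = 0

/-- Vectors spanning an orthogonal summand of `W` on which `B` has Gram matrix `J_s(0)`. -/
structure IsJordanFrame (B : V →ₗ[F] V →ₗ[F] F) (W : Submodule F V) (s : ℕ) (e : ℕ → V) :
    Prop where
  ne : e 0 ≠ 0
  mem : ∀ i < s, e i ∈ W
  left : ∀ w ∈ W, B (e 0) w = 0
  step : ∀ i, i + 2 < s → ∀ w ∈ W, B w (e i) = B (e (i + 2)) w
  right : ∀ w ∈ W, B w (e (s - 1)) = 0
  gram : ∀ i < s, ∀ j < s, B (e i) (e j) = if i = j + 1 then 1 else 0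

theorem exists_eq_on_of_vanish [FiniteDimensional F V] (B : V →ₗ[F] V →ₗ[F] F)
    (A W : Submodule F V) (φ : V →ₗ[F] F)
    (h : ∀ w ∈ W, (∀ a ∈ A, B a w = 0) → φ w = 0) : ∃ a ∈ A, ∀ w ∈ W, B a w = φ w := by
  let f : A →ₗ[F] Module.Dual F W := (LinearMap.lcomp F F W.subtype) ∘ₗ B ∘ₗ A.subtype
  have hmem : φ ∘ₗ W.subtype ∈ LinearMap.range f := by
    rw [← Subspace.dualCoannihilator_dualAnnihilator_eq (W := LinearMap.range f),
      Submodule.mem_dualAnnihilator]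
    intro w hw
    rw [Submodule.mem_dualCoannihilator] at hw
    exact h w w.2 fun a ha => hw _ ⟨⟨a, ha⟩, rfl⟩
  obtain ⟨a, ha⟩ := hmem
  exact ⟨a, a.2, fun w hw => LinearMap.congr_fun ha ⟨w, hw⟩⟩

/-- The right radical of `B` on `W`. -/
def rightRad (B : V →ₗ[F] V →ₗ[F] F) (W : Submodule F V) : Submodule F V where
  carrier := {x | x ∈ W ∧ ∀ w ∈ W, B w x = 0}
  zero_mem' := by simp
  add_mem' := by
    rintro a b ⟨ha, ha'⟩ ⟨hb, hb'⟩
    exact ⟨W.add_mem ha hb, fun w hw => by rw [map_add, ha' w hw, hb' w hw, add_zero]⟩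
  smul_mem' := by
    rintro c a ⟨ha, ha'⟩
    exact ⟨W.smul_mem c ha, fun w hw => by rw [map_smul, ha' w hw, smul_zero]⟩

/-- The vectors of `W` right orthogonal to the right radical. -/
def radPerp (B : V →ₗ[F] V →ₗ[F] F) (W : Submodule F V) : Submodule F V where
  carrier := {x | x ∈ W ∧ ∀ w ∈ rightRad B W, B w x = 0}
  zero_mem' := by simp
  add_mem' := by
    rintro a b ⟨ha, ha'⟩ ⟨hb, hb'⟩
    exact ⟨W.add_mem ha hb, fun w hw => by rw [map_add, ha' w hw, hb' w hw, add_zero]⟩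
  smul_mem' := by
    rintro c a ⟨ha, ha'⟩
    exact ⟨W.smul_mem c ha, fun w hw => by rw [map_smul, ha' w hw, smul_zero]⟩

theorem IsRadicalChain.radPerp {B : V →ₗ[F] V →ₗ[F] F} {W : Submodule F V} {k : ℕ} {v : ℕ → V}
    (h : IsRadicalChain B W (k + 1) v) : IsRadicalChain B (radPerp B W) k v where
  ne := h.ne
  mem i hi := ⟨h.mem i (by omega), fun w hw => by
    rw [h.step i (by omega) w hw.1]
    exact hw.2 _ (h.mem _ (by omega))⟩
  left w hw := h.left w hw.1
  step i hi w hw := h.step i (by omega) w hw.1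
  right w hw := by
    rw [h.step k (by omega) w hw.1]
    exact hw.2 _ ⟨h.mem _ le_rfl, h.right⟩

theorem IsJordanFrame.exists_top [FiniteDimensional F V] {B : V →ₗ[F] V →ₗ[F] F}
    {W : Submodule F V} {s : ℕ} {x : ℕ → V} {t : V} (hs : Odd s)
    (hx : IsJordanFrame B (_root_.radPerp B W) s x) (h0 : x 0 ∉ rightRad B W)
    (ht : t ∈ rightRad B W) (htx : ∀ w ∈ W, B t w = B w (x (s - 1))) :
    ∃ u ∈ W, (3 ≤ s → ∀ w ∈ W, B w (x (s - 2)) = B u w) ∧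
      (∀ j < s, B u (x j) = if s = j + 1 then 1 else 0) ∧ B u u = 0 := by
  by_cases h3 : 3 ≤ s
  · obtain ⟨u, hu, hu'⟩ := exists_eq_on_of_vanish B W W (B.flip (x (s - 2)))
      fun w hw hw' => (hx.mem (s - 2) (by omega)).2 w ⟨hw, hw'⟩
    have hux : ∀ j < s, B u (x j) = if s = j + 1 then 1 else 0 := by
      intro j hj
      rw [hu' _ (hx.mem j hj).1, LinearMap.flip_apply, hx.gram j hj _ (by omega)]
      exact if_congr (by omega) rfl rfl
    refine ⟨u, hu, fun _ w hw => (hu' w hw).symm, hux, ?_⟩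
    rw [hu' u hu, LinearMap.flip_apply, hux _ (by omega), if_neg (by omega)]
  · obtain rfl : s = 1 := by
      obtain ⟨m, rfl⟩ := hs
      omega
    have hx0 := (hx.mem 0 one_pos).1
    obtain ⟨a, ha, hax⟩ : ∃ a ∈ W, B a (x 0) ≠ 0 := by
      by_contra! hcon
      exact h0 ⟨hx0, hcon⟩
    set b := (B a (x 0))⁻¹ • a with hb
    have hbW : b ∈ W := W.smul_mem _ ha
    have hbx : B b (x 0) = 1 := by simp [hb, hax]
    have htb : B t b = 1 := by rw [htx b hbW]; exact hbx
    have htt : ∀ w ∈ W, B w t = 0 := ht.2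
    have ht0 : B t (x 0) = 0 := (hx.mem 0 one_pos).2 t ht
    refine ⟨b - B b b • t, W.sub_mem hbW (W.smul_mem _ ht.1), by omega, ?_, ?_⟩
    · intro j hj
      obtain rfl : j = 0 := by omega
      simp [hbx, ht0]
    · simp [htb, htt b hbW, htt t ht.1]

theorem IsJordanFrame.lift [FiniteDimensional F V] {B : V →ₗ[F] V →ₗ[F] F}
    {W : Submodule F V} {s : ℕ} {x : ℕ → V} (hs : Odd s)
    (hx : IsJordanFrame B (_root_.radPerp B W) s x) (h0 : x 0 ∉ rightRad B W)
    (hl : ∀ w ∈ W, B (x 0) w = 0) :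
    ∃ e, IsJordanFrame B W (s + 2) e ∧ e 0 = x 0 := by
  have hsp := hs.pos
  obtain ⟨t, ht, htx⟩ := exists_eq_on_of_vanish B (rightRad B W) W (B.flip (x (s - 1)))
    fun w hw hw' => hx.right w ⟨hw, hw'⟩
  obtain ⟨u, hu, hu3, hux, huu⟩ := hx.exists_top hs h0 ht htx
  have htu : B t u = 1 := by
    rw [htx u hu, LinearMap.flip_apply, hux _ (by omega), if_pos (by omega)]
  have hm : ∀ i, ∃ m ∈ rightRad B W, (i = 0 → m = 0) ∧ (i = 1 → m = -(B (x 1) u • t)) ∧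
      (2 ≤ i → i < s → ∀ w ∈ W, B w (x (i - 2)) = B (x i + m) w) := by
    intro i
    rcases i with _ | _ | i
    · exact ⟨0, zero_mem _, fun _ => rfl, by omega, by omega⟩
    · exact ⟨_, neg_mem (Submodule.smul_mem _ _ ht), by omega, fun _ => rfl, by omega⟩
    · by_cases hi : i + 2 < s
      · obtain ⟨m, hm, hm'⟩ := exists_eq_on_of_vanish B (rightRad B W) W
          (B.flip (x i) - B (x (i + 2))) fun w hw hw' => by
            simp [hx.step i hi w ⟨hw, hw'⟩]
        refine ⟨m, hm, by omega, by omega, fun _ _ w hw => ?_⟩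
        have := hm' w hw
        simp only [LinearMap.sub_apply, LinearMap.flip_apply] at this
        rw [map_add, LinearMap.add_apply, this]
        simp
      · exact ⟨0, zero_mem _, by omega, by omega, by omega⟩
  choose m hmN hm0 hm1 hm2 using hm
  have hy : ∀ i < s, x i + m i ∈ W := fun i hi => W.add_mem (hx.mem i hi).1 (hmN i).1
  have hyr : ∀ i, ∀ w ∈ W, B w (x i + m i) = B w (x i) := fun i w hw => by
    rw [map_add, (hmN i).2 w hw, add_zero]
  have hyu : ∀ i < s, B (x i + m i) u = 0 := by
    intro i hi
    rcases i with _ | _ | i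
    · rw [hm0 0 rfl, add_zero, hl u hu]
    · rw [hm1 1 rfl, map_add, LinearMap.add_apply]
      simp [htu]
    · rw [← hm2 (i + 2) (by omega) hi u hu, hux _ (by omega), if_neg (by omega)]
  refine ⟨fun i => if i < s then x i + m i else if i = s then u else t,
    ⟨?_, ?_, ?_, ?_, ?_, ?_⟩, ?_⟩
  · simpa [hsp, hm0] using hx.ne
  · intro i hi
    split_ifs with h1 h2
    exacts [hy i h1, hu, ht.1]
  · simpa [hsp, hm0] using hl
  · intro i hi w hw
    by_cases h1 : i + 2 < s
    · rw [if_pos (by omega), if_pos h1, hyr i w hw]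
      exact hm2 (i + 2) (by omega) h1 w hw
    · by_cases h2 : i + 2 = s
      · rw [if_pos (by omega), if_neg (by omega), if_pos h2, hyr i w hw]
        obtain rfl : i = s - 2 := by omega
        refine hu3 ?_ w hw
        obtain ⟨q, rfl⟩ := hs
        omega
      · rw [if_pos (by omega), if_neg (by omega), if_neg (by omega), hyr i w hw, htx w hw]
        obtain rfl : i = s - 1 := by omega
        rfl
  · intro w hw
    rw [if_neg (by omega), if_neg (by omega)]
    exact ht.2 w hw
  · intro i hi j hj
    by_cases hjs : j < s
    · rw [if_pos hjs]
      by_cases his : i < s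
      · rw [if_pos his, hyr j _ (hy i his), map_add, LinearMap.add_apply,
          (hx.mem j hjs).2 _ (hmN i), add_zero, hx.gram i his j hjs]
      · rw [if_neg his]
        by_cases his' : i = s
        · rw [if_pos his', hyr j _ hu, hux j hjs, his']
        · rw [if_neg his', hyr j _ ht.1, (hx.mem j hjs).2 t ht, if_neg (by omega)]
    · rw [if_neg hjs]
      by_cases hjs' : j = s
      · rw [if_pos hjs']
        by_cases his : i < s
        · rw [if_pos his, hyu i his, if_neg (by omega)]
        · rw [if_neg his]
          by_cases his' : i = s
          · rw [if_pos his', huu, if_neg (by omega)]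
          · rw [if_neg his', htu, if_pos (by omega)]
      · rw [if_neg hjs', if_neg (show ¬ i = j + 1 by omega)]
        refine ht.2 _ ?_
        split_ifs with h1 h2
        exacts [hy i h1, hu, ht.1]
  · simp [hsp, hm0]

theorem IsRadicalChain.exists_isJordanFrame [FiniteDimensional F V] {B : V →ₗ[F] V →ₗ[F] F}
    {W : Submodule F V} {k : ℕ} {v : ℕ → V} (h : IsRadicalChain B W k v) :
    ∃ s e, Odd s ∧ IsJordanFrame B W s e ∧ e 0 = v 0 := by
  induction k generalizing W with
  | zero =>
    exact ⟨1, fun _ => v 0, odd_one, ⟨h.ne, fun _ _ => h.mem 0 le_rfl, h.left, by omega, h.right,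
      fun i hi j hj => by rw [if_neg (by omega), h.left _ (h.mem 0 le_rfl)]⟩, rfl⟩
  | succ k ih =>
    by_cases h0 : v 0 ∈ rightRad B W
    · exact ⟨1, fun _ => v 0, odd_one, ⟨h.ne, fun _ _ => h0.1, h.left, by omega, h0.2,
        fun i hi j hj => by rw [if_neg (by omega), h.left _ h0.1]⟩, rfl⟩
    · obtain ⟨s, x, hs, hx, hx0⟩ := ih h.radPerp
      obtain ⟨e, he, he0⟩ := hx.lift hs (by rwa [hx0]) (by rw [hx0]; exact h.left)
      exact ⟨s + 2, e, by rw [Nat.odd_add]; simp [hs], he, he0.trans hx0⟩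

end Chains

section SingularPairs

variable {n r s : ℕ}

/-- A polynomial solution of `(Mᵀ - xM) v = 0` with nonzero constant term, given by its
coefficients. -/
def HasRadicalChain (M : Matrix (Fin n) (Fin n) F) : Prop :=
  ∃ (k : ℕ) (v : ℕ → Fin n → F), v 0 ≠ 0 ∧ Mᵀ *ᵥ v 0 = 0 ∧
    (∀ i < k, M *ᵥ v i = Mᵀ *ᵥ v (i + 1)) ∧ M *ᵥ v k = 0

theorem jordanBlock_mul_apply {m : Type*} (D : Matrix (Fin s) m F) (i : Fin s) (j : m) :
    (jordanBlock s (0 : F) * D) i j = if (i : ℕ) = 0 then 0 else D ⟨i - 1, by omega⟩ j := by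
  have h : jordanBlock s (0 : F) * D = (Dᵀ * shift F s)ᵀ := by
    rw [Matrix.transpose_mul, shift, Matrix.transpose_transpose, Matrix.transpose_transpose]
  rw [h, transpose_apply, mul_shift_apply]
  rfl

theorem mul_jordanBlock_apply {m : Type*} (D : Matrix m (Fin s) F) (i : m) (j : Fin s) :
    (D * jordanBlock s (0 : F)) i j = if h : (j : ℕ) + 1 < s then D i ⟨j + 1, h⟩ else 0 := by
  have h : D * jordanBlock s (0 : F) = (shift F s * Dᵀ)ᵀ := by
    rw [Matrix.transpose_mul, shift, Matrix.transpose_transpose, Matrix.transpose_transpose]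
  rw [h, transpose_apply, shift_mul_apply]
  rfl

theorem exists_split_of_isJordanFrame {M : Matrix (Fin n) (Fin n) F} (hs : Odd s)
    {e : ℕ → Fin n → F} (he : IsJordanFrame (Matrix.toLinearMap₂' F M) ⊤ s e) :
    ∃ (p : Matrix (Fin s) (Fin n) F) (Y : Matrix (Fin n) (Fin s) F), p * Y = 1 ∧
      Yᵀ * M = jordanBlock s (0 : F) * p ∧ M * Y = pᵀ * jordanBlock s (0 : F) := by
  have hleft : e 0 ᵥ* M = 0 := by
    refine dotProduct_eq_zero _ fun w => ?_
    rw [← Matrix.dotProduct_mulVec, ← Matrix.toLinearMap₂'_apply']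
    exact he.left w trivial
  have hright : M *ᵥ e (s - 1) = 0 := by
    refine dotProduct_eq_zero _ fun w => ?_
    rw [dotProduct_comm, ← Matrix.toLinearMap₂'_apply']
    exact he.right w trivial
  have hstep : ∀ i, i + 2 < s → e (i + 2) ᵥ* M = M *ᵥ e i := by
    intro i hi
    refine dotProduct_eq _ _ fun w => ?_
    rw [← Matrix.dotProduct_mulVec, ← Matrix.toLinearMap₂'_apply', dotProduct_comm,
      ← Matrix.toLinearMap₂'_apply']
    exact (he.step i hi w trivial).symm
  obtain ⟨l, hl, hl'⟩ : ∃ l : Fin n → F, (∀ j < s, l ⬝ᵥ e j = if j = s - 1 then 1 else 0) ∧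
      (3 ≤ s → l = M *ᵥ e (s - 2)) := by
    by_cases h3 : 3 ≤ s
    · refine ⟨M *ᵥ e (s - 2), fun j hj => ?_, fun _ => rfl⟩
      rw [dotProduct_comm, ← Matrix.toLinearMap₂'_apply', he.gram j hj _ (by omega)]
      exact if_congr (by omega) rfl rfl
    · obtain ⟨a, ha⟩ := Function.ne_iff.1 he.ne
      refine ⟨Pi.single a (e 0 a)⁻¹, fun j hj => ?_, by omega⟩
      obtain ⟨m, rfl⟩ := hs
      obtain rfl : j = 0 := by omega
      rw [if_pos (by omega), single_dotProduct, inv_mul_cancel₀ ha]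
  refine ⟨of fun i a => if (i : ℕ) + 1 < s then (e (i + 1) ᵥ* M) a else l a,
    of fun a j => e j a, ?_, ?_, ?_⟩
  · ext i j
    rw [Matrix.one_apply]
    by_cases hi : (i : ℕ) + 1 < s
    · have h := he.gram _ hi j j.2
      rw [Matrix.toLinearMap₂'_apply', Matrix.dotProduct_mulVec] at h
      simp only [Matrix.mul_apply, of_apply, if_pos hi]
      refine h.trans (if_congr ?_ rfl rfl)
      rw [Fin.ext_iff]
      omega
    · simp only [Matrix.mul_apply, of_apply, if_neg hi]
      refine (hl j j.2).trans (if_congr ?_ rfl rfl)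
      rw [Fin.ext_iff]
      omega
  · ext i a
    have h1 : ((of fun a (j : Fin s) => e j a)ᵀ * M) i a = (e i ᵥ* M) a := rfl
    rw [h1, jordanBlock_mul_apply]
    split_ifs with h
    · rw [h, hleft]
      rfl
    · rw [of_apply, if_pos (by simp only; omega)]
      simp only
      rw [Nat.sub_add_cancel (by omega)]
  · ext a j
    have h1 : (M * (of fun a (j : Fin s) => e j a)) a j = (M *ᵥ e j) a := rfl
    rw [h1, mul_jordanBlock_apply]
    split_ifs with h
    · rw [transpose_apply, of_apply]
      split_ifs with h2
      · rw [← hstep _ h2]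
      · simp only at h2
        rw [hl' (by obtain ⟨q, rfl⟩ := hs; omega)]
        congr 3
        omega
    · rw [show (j : ℕ) = s - 1 by omega, hright]
      rfl

theorem HasRadicalChain.exists_split {M : Matrix (Fin n) (Fin n) F} (h : HasRadicalChain M) :
    ∃ s, Odd s ∧ ∃ (p : Matrix (Fin s) (Fin n) F) (Y : Matrix (Fin n) (Fin s) F), p * Y = 1 ∧
      Yᵀ * M = jordanBlock s (0 : F) * p ∧ M * Y = pᵀ * jordanBlock s (0 : F) := by
  obtain ⟨k, v, h0, hl, hst, hr⟩ := h
  have hc : IsRadicalChain (Matrix.toLinearMap₂' F M) ⊤ k v := by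
    refine ⟨h0, fun _ _ => trivial, fun w _ => ?_, fun i hi w _ => ?_, fun w _ => ?_⟩
    · rw [Matrix.toLinearMap₂'_apply', Matrix.dotProduct_mulVec, ← Matrix.mulVec_transpose, hl,
        zero_dotProduct]
    · rw [Matrix.toLinearMap₂'_apply', Matrix.toLinearMap₂'_apply', hst i hi,
        Matrix.dotProduct_mulVec (v (i + 1)), ← Matrix.mulVec_transpose, dotProduct_comm]
    · rw [Matrix.toLinearMap₂'_apply', hr, dotProduct_zero]
  obtain ⟨s, e, hs, he, -⟩ := hc.exists_isJordanFrame
  exact ⟨s, hs, exists_split_of_isJordanFrame hs he⟩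

theorem HasRadicalChain.not_xiMem (hchar : (2 : F) ≠ 0) {M : Matrix (Fin n) (Fin n) F}
    (h : HasRadicalChain M) : ¬ XiMem M := by
  obtain ⟨s, hs, p, Y, h1, h2, h3⟩ := h.exists_split
  exact not_xiMem_of_split hchar hs h1 h2 h3

theorem HasRadicalChain.exists_pairSummand {M : Matrix (Fin n) (Fin n) F}
    (h : HasRadicalChain M) : ∃ s, Odd s ∧
      PairSummand Mᵀ M (jordanBlock s (0 : F))ᵀ (jordanBlock s (0 : F)) := by
  obtain ⟨s, hs, p, Y, h1, h2, h3⟩ := h.exists_split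
  refine ⟨s, hs, pairSummand_of_split (X := Yᵀ) (q := pᵀ) h1 ?_ ?_ h2 ?_ h3⟩
  · rw [← Matrix.transpose_mul, h1, Matrix.transpose_one]
  · rw [← Matrix.transpose_mul, h3, Matrix.transpose_mul, Matrix.transpose_transpose]
  · rw [← Matrix.transpose_transpose Y, ← Matrix.transpose_mul, h2, Matrix.transpose_mul]

theorem PairSummand.hasRadicalChain {M : Matrix (Fin n) (Fin n) F} (hs : Odd s)
    (h : PairSummand Mᵀ M (jordanBlock s (0 : F))ᵀ (jordanBlock s (0 : F))) :
    HasRadicalChain M := by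
  obtain ⟨-, p, Y, q, h1, -, -, -, h2, h3⟩ := h.exists_split
  obtain ⟨k, rfl⟩ := hs
  let y : ℕ → Fin n → F := fun i a => if h : 2 * i < 2 * k + 1 then Y a ⟨2 * i, h⟩ else 0
  have hy : ∀ i (h : 2 * i < 2 * k + 1), y i = fun a => Y a ⟨2 * i, h⟩ := fun i h =>
    funext fun a => dif_pos h
  have hMt : ∀ i (h : 2 * i < 2 * k + 1), Mᵀ *ᵥ y i = fun a =>
      (q * shift F (2 * k + 1)) a ⟨2 * i, h⟩ := by
    intro i h
    rw [hy i h]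
    funext a
    exact congr_fun (congr_fun h2 a) ⟨2 * i, h⟩
  have hM : ∀ i (h : 2 * i < 2 * k + 1), M *ᵥ y i = fun a =>
      (q * jordanBlock (2 * k + 1) (0 : F)) a ⟨2 * i, h⟩ := by
    intro i h
    rw [hy i h]
    funext a
    exact congr_fun (congr_fun h3 a) ⟨2 * i, h⟩
  refine ⟨k, y, ?_, ?_, ?_, ?_⟩
  · intro h0
    have := congr_fun (congr_fun h1 ⟨2 * 0, by omega⟩) ⟨2 * 0, by omega⟩
    rw [Matrix.one_apply_eq, Matrix.mul_apply] at this
    rw [hy 0 (by omega)] at h0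
    simp only [fun a => congr_fun h0 a] at this
    simp at this
  · rw [hMt 0 (by omega)]
    funext a
    rw [mul_shift_apply]
    rfl
  · intro i hi
    rw [hM i (by omega), hMt (i + 1) (by omega)]
    funext a
    rw [mul_shift_apply, mul_jordanBlock_apply, dif_pos (by simp only; omega),
      if_neg (by simp only; omega)]
    rfl
  · rw [hM k (by omega)]
    funext a
    rw [mul_jordanBlock_apply, dif_neg (by simp only; omega)]
    rfl

theorem hasRadicalChain_of_det_pencil_eq_zero {M : Matrix (Fin n) (Fin n) F}
    (h : (pencil M Mᵀ).det = 0) : HasRadicalChain M := by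
  classical
  obtain ⟨g, hg, hgz⟩ := Matrix.exists_mulVec_eq_zero_iff.2 h
  obtain ⟨b, hb⟩ := Function.ne_iff.1 hg
  let G : Matrix (Fin n) (Fin n) F[X] := of fun a _ => g a
  have hG : pencil M Mᵀ * G = 0 := by
    ext1 i j
    exact congr_fun hgz i
  have hsucc : ∀ i, M *ᵥ (fun a => (g a).coeff i) = Mᵀ *ᵥ fun a => (g a).coeff (i + 1) := by
    intro i
    have := coeff_pencil_mul M Mᵀ G i
    rw [hG] at this
    funext a
    have h' := congr_fun (congr_fun this a) b
    rw [Matrix.map_apply, Matrix.zero_apply, coeff_zero, Matrix.sub_apply, eq_comm, sub_eq_zero,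
      eq_comm] at h'
    exact h'
  have hzero : Mᵀ *ᵥ (fun a => (g a).coeff 0) = 0 := by
    have := coeff_zero_pencil_mul M Mᵀ G
    rw [hG] at this
    funext a
    have h' := congr_fun (congr_fun this a) b
    rw [Matrix.map_apply, Matrix.zero_apply, coeff_zero, eq_comm] at h'
    exact h'
  have hex : ∃ m, (fun a => (g a).coeff m) ≠ 0 := by
    by_contra! hcon
    exact hb (Polynomial.ext fun m => congr_fun (hcon m) b)
  obtain ⟨N, hN⟩ : ∃ N, ∀ m ≥ N, (fun a => (g a).coeff m) = 0 := by
    refine ⟨∑ a, (g a).natDegree + 1, fun m hm => funext fun a => coeff_eq_zero_of_natDegree_lt ?_⟩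
    have := Finset.single_le_sum (f := fun a => (g a).natDegree) (fun _ _ => Nat.zero_le _)
      (Finset.mem_univ a)
    omega
  refine ⟨N,
    fun i a => (g a).coeff (Nat.find hex + i), Nat.find_spec hex, ?_, fun i _ => hsucc _, ?_⟩
  · simp only [add_zero]
    rcases hm : Nat.find hex with _ | m
    · exact hzero
    · have := Nat.find_min hex (m := m) (by omega)
      rw [not_not] at this
      rw [← hsucc, this, Matrix.mulVec_zero]
  · exact (congr_arg (M *ᵥ ·) (hN (Nat.find hex + N) (by omega))).trans (Matrix.mulVec_zero M)

end SingularPairs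

section Isometries

variable {n r : ℕ}

theorem transpose_isometry {M S : Matrix (Fin n) (Fin n) F} (hS : Sᵀ * M * S = M) :
    Sᵀ * Mᵀ * S = Mᵀ := by
  have := congr_arg transpose hS
  rwa [Matrix.transpose_mul, Matrix.transpose_mul, Matrix.transpose_transpose,
    ← Matrix.mul_assoc] at this

theorem det_eq_one_of_det_add_one_ne_zero {M S : Matrix (Fin n) (Fin n) F}
    (hP : (pencil M Mᵀ).det ≠ 0) (hS : Sᵀ * M * S = M) (h : (S + 1).det ≠ 0) : S.det = 1 := by
  have hS' := transpose_isometry hS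
  have hC : ∀ A B : Matrix (Fin n) (Fin n) F, (A * B).map C = A.map C * B.map C :=
    fun A B => Matrix.map_mul
  have h1 : Sᵀ.map C * pencil M Mᵀ * S.map C = pencil M Mᵀ := by
    rw [pencil, Matrix.mul_sub, Matrix.sub_mul, Matrix.mul_smul, Matrix.smul_mul, ← hC, ← hC,
      ← hC, ← hC, hS, hS']
  have h2 : Sᵀ.map C * pencil M Mᵀ * (S + 1).map C = (S + 1)ᵀ.map C * pencil M Mᵀ := by
    rw [Matrix.map_add C (fun _ _ => C_add), Matrix.mul_add, h1, Matrix.transpose_add,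
      Matrix.map_add C (fun _ _ => C_add), Matrix.add_mul, Matrix.transpose_one]
    simp [add_comm]
  have hd : ∀ A : Matrix (Fin n) (Fin n) F, (A.map C).det = C A.det := fun A =>
    (RingHom.map_det C A).symm
  have h3 := congr_arg Matrix.det h2
  rw [Matrix.det_mul, Matrix.det_mul, Matrix.det_mul, hd, hd, hd, Matrix.det_transpose,
    Matrix.det_transpose] at h3
  have h4 : (C S.det - 1) * ((pencil M Mᵀ).det * C (S + 1).det) = 0 := by
    linear_combination h3
  rw [mul_eq_zero, or_iff_left (mul_ne_zero hP (C_ne_zero.2 h)), sub_eq_zero, ← C_1] at h4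
  exact C_injective h4

/-- The Fitting decomposition of a square matrix. -/
theorem exists_fitting (T : Matrix (Fin n) (Fin n) F) :
    ∃ (k : ℕ) (E Q : Matrix (Fin n) (Fin n) F), E * E = E ∧ T ^ (k + 1) * E = 0 ∧
      E + Q * T ^ (k + 1) = 1 ∧ Commute T E ∧ Commute T Q := by
  obtain ⟨g, hg, hX⟩ := exists_eq_pow_rootMultiplicity_mul_and_not_dvd T.charpoly
    (charpoly_monic T).ne_zero 0
  rw [C_0, sub_zero] at hg hX
  set k := rootMultiplicity 0 T.charpoly
  obtain ⟨a, b, hab⟩ : IsCoprime ((X : F[X]) ^ (k + 1)) g :=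
    IsCoprime.pow_left ((irreducible_X.coprime_iff_not_dvd).2 hX)
  have hsum : aeval T (b * g) + aeval T a * T ^ (k + 1) = 1 := by
    rw [← aeval_X_pow (R := F), ← map_mul, ← map_add, add_comm, hab, map_one]
  have hzero : T ^ (k + 1) * aeval T (b * g) = 0 := by
    rw [← aeval_X_pow (R := F), ← map_mul,
      show (X : F[X]) ^ (k + 1) * (b * g) = (X * b) * (X ^ k * g) by ring, ← hg, map_mul,
      Matrix.aeval_self_charpoly, mul_zero]
  have hcomm : ∀ f : F[X], Commute T (aeval T f) := fun f => by
    have h := congr_arg (aeval T) (mul_comm (X : F[X]) f)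
    rw [map_mul, map_mul, aeval_X] at h
    exact h
  refine ⟨k, aeval T (b * g), aeval T a, ?_, hzero, hsum, hcomm _, hcomm _⟩
  have h := congr_arg (· * aeval T (b * g)) hsum
  simp only [add_mul, one_mul, mul_assoc, hzero, mul_zero, add_zero] at h
  exact h

theorem fitting_orthogonal {M S E Q : Matrix (Fin n) (Fin n) F} {k : ℕ}
    (hS : Sᵀ * M * S = M) (h0 : (S + 1) ^ k * E = 0) (h1 : E + Q * (S + 1) ^ k = 1)
    (hQ : Commute (S + 1) Q) : Eᵀ * M = Eᵀ * M * E := by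
  have hpow : ∀ k, M * (S + 1) ^ k = ((S + 1) ^ k)ᵀ * M * S ^ k := by
    intro k
    induction k with
    | zero => simp
    | succ k ih =>
      have hc : Commute (S ^ k) (S + 1) :=
        ((Commute.refl S).add_right (Commute.one_right S)).pow_left k
      have h1 : M * (S + 1) = (S + 1)ᵀ * M * S := by
        rw [Matrix.transpose_add, Matrix.add_mul, Matrix.add_mul, hS, Matrix.mul_add]
        simp [add_comm]
      calc M * (S + 1) ^ (k + 1) = ((S + 1) ^ k)ᵀ * M * (S ^ k * (S + 1)) := by
            rw [pow_succ, ← mul_assoc, ih, mul_assoc]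
        _ = ((S + 1) ^ k)ᵀ * (M * (S + 1)) * S ^ k := by rw [hc.eq]; simp only [mul_assoc]
        _ = _ := by
          rw [h1, pow_succ' (S + 1), Matrix.transpose_mul, pow_succ' S]
          simp only [mul_assoc]
  have h2 : E + (S + 1) ^ k * Q = 1 := by rw [(hQ.pow_left k).eq, h1]
  calc Eᵀ * M = Eᵀ * M * (E + (S + 1) ^ k * Q) := by rw [h2, mul_one]
    _ = Eᵀ * M * E + Eᵀ * (M * (S + 1) ^ k) * Q := by simp only [mul_add, mul_assoc]
    _ = Eᵀ * M * E + ((S + 1) ^ k * E)ᵀ * M * S ^ k * Q := by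
      rw [hpow, Matrix.transpose_mul]
      simp only [mul_assoc]
    _ = _ := by simp [h0]

theorem det_reflect_add_one_ne_zero (hchar : (2 : F) ≠ 0) {S E Q : Matrix (Fin n) (Fin n) F}
    {k : ℕ} (hE : E * E = E) (h0 : (S + 1) ^ (k + 1) * E = 0)
    (h1 : E + Q * (S + 1) ^ (k + 1) = 1) (hc : Commute (S + 1) E) :
    (S * (1 - (2 : F) • E) + 1).det ≠ 0 := by
  intro hdet
  obtain ⟨v, hv0, hv⟩ := Matrix.exists_mulVec_eq_zero_iff.2 hdet
  set T := S + 1 with hT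
  have hS : S = T - 1 := by rw [hT, add_sub_cancel_right]
  have e1 : S * (1 - (2 : F) • E) + 1 = T - (2 : F) • (T * E) + (2 : F) • E := by
    rw [hS, mul_sub, mul_one, Matrix.mul_smul, sub_mul, one_mul, smul_sub]
    abel
  have e2 : E * (S * (1 - (2 : F) • E) + 1) = (2 : F) • E - T * E := by
    rw [e1, mul_add, mul_sub, Matrix.mul_smul, Matrix.mul_smul, hE, ← mul_assoc, ← hc.eq,
      mul_assoc, hE, two_smul F (T * E)]
    abel
  have h2 : T *ᵥ (E *ᵥ v) = (2 : F) • (E *ᵥ v) := by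
    have := congr_arg (E *ᵥ ·) hv
    simp only [Matrix.mulVec_mulVec, Matrix.mulVec_zero] at this
    rw [e2, Matrix.sub_mulVec, sub_eq_zero, Matrix.smul_mulVec] at this
    rw [Matrix.mulVec_mulVec, this]
  have h3 : ∀ m, T ^ m *ᵥ (E *ᵥ v) = (2 : F) ^ m • (E *ᵥ v) := by
    intro m
    induction m with
    | zero => simp
    | succ m ih => rw [pow_succ, ← Matrix.mulVec_mulVec, h2, Matrix.mulVec_smul, ih, smul_smul,
        pow_succ']
  have h4 : E *ᵥ v = 0 := by
    have := h3 (k + 1)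
    rw [Matrix.mulVec_mulVec, h0, Matrix.zero_mulVec, eq_comm, smul_eq_zero] at this
    exact this.resolve_left (pow_ne_zero _ hchar)
  have h5 : T *ᵥ v = 0 := by
    rw [e1, Matrix.add_mulVec, Matrix.sub_mulVec, Matrix.smul_mulVec, Matrix.smul_mulVec,
      ← Matrix.mulVec_mulVec, h4] at hv
    simpa using hv
  have h6 := congr_arg (· *ᵥ v) h1
  simp only [Matrix.add_mulVec, h4, Matrix.one_mulVec, pow_succ, ← Matrix.mulVec_mulVec, h5,
    Matrix.mulVec_zero, add_zero] at h6
  exact hv0 h6.symm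

theorem det_one_sub_two_smul {p : Matrix (Fin r) (Fin n) F} {Y : Matrix (Fin n) (Fin r) F}
    (h : p * Y = 1) : (1 - (2 : F) • (Y * p)).det = (-1) ^ r := by
  rw [← Matrix.mul_smul, Matrix.det_one_sub_mul_comm, Matrix.smul_mul, h,
    show (1 : Matrix (Fin r) (Fin r) F) - (2 : F) • 1 = -1 by rw [two_smul]; abel, Matrix.det_neg,
    Matrix.det_one, mul_one, Fintype.card_fin]

/-- If `M` has an isometry of determinant other than one, it has an odd-dimensional orthogonal
summand. -/
theorem exists_odd_orthogonal_split (hchar : (2 : F) ≠ 0) {M : Matrix (Fin n) (Fin n) F}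
    (hP : (pencil M Mᵀ).det ≠ 0) (hM : ¬ XiMem M) :
    ∃ (r : ℕ) (_ : Odd r) (p : Matrix (Fin r) (Fin n) F) (Y : Matrix (Fin n) (Fin r) F),
      p * Y = 1 ∧ M * Y = pᵀ * (Yᵀ * M * Y) ∧ Mᵀ * Y = pᵀ * (Yᵀ * Mᵀ * Y) := by
  simp only [XiMem, not_forall] at hM
  obtain ⟨S, -, hS, hdet⟩ := hM
  obtain ⟨k, E, Q, hE, h0, h1, hTE, hTQ⟩ := exists_fitting (S + 1)
  have o1 := fitting_orthogonal hS h0 h1 hTQ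
  have o2 : ∀ N : Matrix (Fin n) (Fin n) F, Nᵀ * E = Eᵀ * Nᵀ * E ↔ Eᵀ * N = Eᵀ * N * E := by
    intro N
    rw [← Matrix.transpose_inj]
    simp only [Matrix.transpose_mul, Matrix.transpose_transpose, Matrix.mul_assoc]
  have o3 : Mᵀ * E = Eᵀ * Mᵀ * E := (o2 M).2 o1
  have o4 : M * E = Eᵀ * M * E := by
    have := (o2 Mᵀ).2 (fitting_orthogonal (transpose_isometry hS) h0 h1 hTQ)
    rwa [Matrix.transpose_transpose] at this
  obtain ⟨r, Y, p, hpY, hYp⟩ := exists_factor_of_idempotent E hE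
  have hEY : E * Y = Y := by rw [← hYp, Matrix.mul_assoc, hpY, Matrix.mul_one]
  have hEt : Eᵀ = pᵀ * Yᵀ := by rw [← hYp, Matrix.transpose_mul]
  have tr : ∀ N : Matrix (Fin n) (Fin n) F, N * E = Eᵀ * N * E → N * Y = pᵀ * (Yᵀ * N * Y) := by
    intro N hN
    calc N * Y = N * E * Y := by rw [Matrix.mul_assoc, hEY]
      _ = Eᵀ * N * Y := by rw [hN, Matrix.mul_assoc, hEY]
      _ = _ := by rw [hEt]; simp only [Matrix.mul_assoc]
  refine ⟨r, ?_, p, Y, hpY, tr M o4, tr Mᵀ o3⟩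
  set R := 1 - (2 : F) • E with hR
  have hRR : R * R = 1 := by
    rw [hR, sub_mul, one_mul, mul_sub, mul_one, Matrix.smul_mul, Matrix.mul_smul, hE]
    simp only [two_smul]
    abel
  have hRM : Rᵀ * M * R = M := by
    have hMR : M * R = Rᵀ * M := by
      rw [hR, Matrix.transpose_sub, Matrix.transpose_smul, Matrix.transpose_one, mul_sub, sub_mul,
        mul_one, one_mul, Matrix.mul_smul, Matrix.smul_mul, o4.trans o1.symm]
    rw [← hMR, mul_assoc, hRR, mul_one]
  have hSR : (S * R)ᵀ * M * (S * R) = M := by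
    calc (S * R)ᵀ * M * (S * R) = Rᵀ * (Sᵀ * M * S) * R := by
          rw [Matrix.transpose_mul]; simp only [mul_assoc]
      _ = M := by rw [hS, hRM]
  have hd := det_eq_one_of_det_add_one_ne_zero hP hSR
    (det_reflect_add_one_ne_zero hchar hE h0 h1 hTE)
  by_contra hr
  rw [Matrix.det_mul, hR, ← hYp, det_one_sub_two_smul hpY,
    (Nat.not_odd_iff_even.1 hr).neg_one_pow, mul_one] at hd
  exact hdet hd

theorem HasRadicalChain.of_split {M : Matrix (Fin n) (Fin n) F} {A : Matrix (Fin r) (Fin r) F}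
    {p : Matrix (Fin r) (Fin n) F} {Y : Matrix (Fin n) (Fin r) F} (hp : p * Y = 1)
    (h1 : M * Y = pᵀ * A) (h2 : Mᵀ * Y = pᵀ * Aᵀ) (h : HasRadicalChain A) :
    HasRadicalChain M := by
  obtain ⟨k, v, h0, hl, hs, hr⟩ := h
  have e1 : ∀ w, M *ᵥ (Y *ᵥ w) = pᵀ *ᵥ (A *ᵥ w) := fun w => by
    rw [Matrix.mulVec_mulVec, h1, Matrix.mulVec_mulVec]
  have e2 : ∀ w, Mᵀ *ᵥ (Y *ᵥ w) = pᵀ *ᵥ (Aᵀ *ᵥ w) := fun w => by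
    rw [Matrix.mulVec_mulVec, h2, Matrix.mulVec_mulVec]
  refine ⟨k, fun i => Y *ᵥ v i, fun h => h0 ?_, ?_, fun i hi => ?_, ?_⟩
  · have := congr_arg (p *ᵥ ·) h
    simpa [Matrix.mulVec_mulVec, hp] using this
  · rw [e2, hl, Matrix.mulVec_zero]
  · rw [e1, e2, hs i hi]
  · rw [e1, hr, Matrix.mulVec_zero]

theorem det_pencil_cayley_ne_zero (hchar : (2 : F) ≠ 0) {M : Matrix (Fin n) (Fin n) F}
    (h : (pencil M Mᵀ).det ≠ 0) : (pencil (M + Mᵀ) (M - Mᵀ)).det ≠ 0 := by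
  intro h0
  apply h
  set t : RatFunc F := algebraMap F[X] (RatFunc F) X with ht
  have ht1 : 1 + t ≠ 0 := by
    rw [ht, ← map_one (algebraMap F[X] (RatFunc F)), ← map_add]
    refine (map_ne_zero_iff _ (RatFunc.algebraMap_injective F)).2 ?_
    rw [add_comm, ← C_1]
    exact X_add_C_ne_zero 1
  have h2 : (2 : RatFunc F) ≠ 0 := by
    have := (map_ne_zero_iff _ (algebraMap F (RatFunc F)).injective).2 hchar
    rwa [map_ofNat] at this
  let φ : F[X] →+* RatFunc F := (aeval ((1 - t) / (1 + t))).toRingHom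
  have hφ : φ.mapMatrix (pencil (M + Mᵀ) (M - Mᵀ)) =
      (-(2 / (1 + t))) • (algebraMap F[X] (RatFunc F)).mapMatrix (pencil M Mᵀ) := by
    ext i j
    have hC : ∀ c : F, algebraMap F[X] (RatFunc F) (C c) = algebraMap F (RatFunc F) c := by
      intro c
      rw [IsScalarTower.algebraMap_apply F F[X] (RatFunc F)]
      rfl
    simp [φ, pencil, hC, ← ht]
    field_simp
    ring
  have h3 := RingHom.map_det φ (pencil (M + Mᵀ) (M - Mᵀ))
  rw [h0, map_zero, hφ, Matrix.det_smul, ← RingHom.map_det, eq_comm, mul_eq_zero] at h3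
  have h4 := h3.resolve_left (pow_ne_zero _ (neg_ne_zero.2 (div_ne_zero h2 ht1)))
  exact (map_eq_zero_iff _ (RatFunc.algebraMap_injective F)).1 h4

theorem HasShiftBlock.of_split {H K : Matrix (Fin n) (Fin n) F} {H₁ K₁ : Matrix (Fin r) (Fin r) F}
    {p : Matrix (Fin r) (Fin n) F} {Y : Matrix (Fin n) (Fin r) F} {s : ℕ} (hp : p * Y = 1)
    (h1 : H * Y = pᵀ * H₁) (h2 : K * Y = pᵀ * K₁) (h3 : Yᵀ * H = H₁ * p) (h4 : Yᵀ * K = K₁ * p)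
    (h : HasShiftBlock H₁ K₁ s) : HasShiftBlock H K s := by
  obtain ⟨U, V, k1, k2, k3⟩ := h
  refine ⟨U * Yᵀ, Y * V, ?_, ?_, ?_⟩
  · rw [Matrix.mul_assoc U, h3, ← k1]
    rw [Matrix.mul_assoc U, Matrix.mul_assoc H₁, ← Matrix.mul_assoc p, hp, Matrix.one_mul,
      Matrix.mul_assoc]
  · rw [← Matrix.mul_assoc, h2, Matrix.mul_assoc, k2, ← Matrix.mul_assoc H, h1]
    simp only [Matrix.mul_assoc]
  · rw [Matrix.mul_assoc, h4, ← Matrix.mul_assoc, k3, Matrix.mul_assoc U, h3]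
    simp only [Matrix.mul_assoc]

theorem exists_pairSummand_gam (hchar : (2 : F) ≠ 0) {M : Matrix (Fin n) (Fin n) F}
    (hM : ¬ XiMem M) (hc : ¬ HasRadicalChain M) :
    ∃ r, Odd r ∧ PairSummand Mᵀ M (Gam r : Matrix (Fin r) (Fin r) F)ᵀ (Gam r) := by
  have hP : (pencil M Mᵀ).det ≠ 0 := fun h => hc (hasRadicalChain_of_det_pencil_eq_zero h)
  obtain ⟨r, hr, p, Y, hp, h1, h2⟩ := exists_odd_orthogonal_split hchar hP hM
  have hAt : Yᵀ * Mᵀ * Y = (Yᵀ * M * Y)ᵀ := by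
    simp [Matrix.transpose_mul, Matrix.mul_assoc]
  rw [hAt] at h2
  set A := Yᵀ * M * Y
  have h3 : Yᵀ * M = A * p := by
    have := congr_arg transpose h2
    simpa [Matrix.transpose_mul] using this
  have h4 : Yᵀ * Mᵀ = Aᵀ * p := by
    have := congr_arg transpose h1
    simpa [Matrix.transpose_mul] using this
  have hA : (pencil A Aᵀ).det ≠ 0 := fun h =>
    hc ((hasRadicalChain_of_det_pencil_eq_zero h).of_split hp h1 h2)
  have hA' := det_pencil_cayley_ne_zero hchar hA
  obtain ⟨s, hs, hb⟩ := exists_odd_hasShiftBlock hA'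
    (odd_natTrailingDegree_det_pencil hchar hr hA')
  refine ⟨s, hs, HasShiftBlock.pairSummand_gam hchar hs (hb.of_split hp ?_ ?_ ?_ ?_)⟩
  · rw [Matrix.add_mul, Matrix.mul_add, h1, h2]
  · rw [Matrix.sub_mul, Matrix.mul_sub, h1, h2]
  · rw [Matrix.add_mul, Matrix.mul_add, h3, h4]
  · rw [Matrix.sub_mul, Matrix.mul_sub, h3, h4]

end Isometries

/-- `M ∉ Ξ_n(F)` iff `(Mᵀ, M)` has a direct summand for equivalence of the
form `(Γ_rᵀ, Γ_r)` with `r` odd, or `(J_s(0)ᵀ, J_s(0))` with `s` odd. -/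
theorem stmt_16 {F : Type*} [Field F] (hchar : (2 : F) ≠ 0) {n : ℕ}
    (M : Matrix (Fin n) (Fin n) F) :
    ¬ XiMem M ↔
      (∃ r : ℕ, Odd r ∧
        PairSummand Mᵀ M ((Gam r : Matrix (Fin r) (Fin r) F))ᵀ (Gam r)) ∨
      (∃ s : ℕ, Odd s ∧
        PairSummand Mᵀ M (jordanBlock s (0 : F))ᵀ (jordanBlock s (0 : F))) := by
  constructor
  · intro hM
    by_cases hc : HasRadicalChain M
    · exact Or.inr hc.exists_pairSummand
    · exact Or.inl (exists_pairSummand_gam hchar hM hc)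
  · rintro (⟨r, hr, h⟩ | ⟨s, hs, h⟩)
    · exact (h.hasShiftBlock hchar hr).not_xiMem hchar hr
    · exact (h.hasRadicalChain hs).not_xiMem hchar
end

section
/- Let F be a field of characteristic different from 2 and let M be an invertible square matrix over F. Then the cosquare M^{-T}M is similar to a block-diagonal direct sum of matrices, each of which is of one of the following two forms: (a) Φ ⊕ Φ^{-T}, where Φ is an invertible Frobenius block that is not a cosquare; (b) Ψ, where Ψ is a Frobenius block that is a cosquare. -/
open Matrix Polynomial

variable {F : Type*} [Field F]

/-- A canonical block for the similarity classification of cosquares: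
(a) `Φ ⊕ Φ⁻ᵀ` with `Φ` an invertible Frobenius block that is not a cosquare;
(b) a Frobenius block that is a cosquare. -/
def GoodBlock19 {F : Type*} [Field F] {m : ℕ} (A : Matrix (Fin m) (Fin m) F) : Prop :=
  (∃ (r : ℕ) (h : r + r = m) (Φ : Matrix (Fin r) (Fin r) F),
      IsFrobeniusBlock Φ ∧ IsUnit Φ ∧ ¬ IsCosquare Φ ∧
      A = Matrix.reindex (finCongr h) (finCongr h) (dSum Φ (Φ⁻¹ᵀ))) ∨
  (IsFrobeniusBlock A ∧ IsCosquare A)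

theorem AdjoinRoot.pow_mem_of_mem_ideal {p : F[X]} (hp : Irreducible p) {l : ℕ}
    (K : Ideal (AdjoinRoot (p ^ (l + 1)))) {a : AdjoinRoot (p ^ (l + 1))} (ha : a ∈ K)
    (ha0 : a ≠ 0) : AdjoinRoot.mk (p ^ (l + 1)) (p ^ l) ∈ K := by
  obtain ⟨f, rfl⟩ := AdjoinRoot.mk_surjective a
  have hf0 : f ≠ 0 := by rintro rfl; simp at ha0
  obtain ⟨k, u, hu, rfl⟩ :=
    WfDvdMonoid.max_power_factor hf0 hp
  have hk : k ≤ l := by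
    by_contra! h
    exact ha0 (AdjoinRoot.mk_eq_zero.2 ((pow_dvd_pow p h).mul_right u))
  obtain ⟨s, t, hst⟩ : IsCoprime (p ^ (l + 1)) u :=
    IsCoprime.pow_left ((hp.coprime_iff_not_dvd).2 hu)
  have key : AdjoinRoot.mk (p ^ (l + 1)) (p ^ l) =
      AdjoinRoot.mk (p ^ (l + 1)) (t * p ^ (l - k)) * AdjoinRoot.mk (p ^ (l + 1)) (p ^ k * u) := by
    rw [← map_mul, AdjoinRoot.mk_eq_mk]
    refine ⟨s * p ^ l, ?_⟩
    have : p ^ l = p ^ (l - k) * p ^ k := by rw [← pow_add, Nat.sub_add_cancel hk]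
    linear_combination (-(p ^ l)) * hst + t * u * this
  rw [key]
  exact K.mul_mem_left _ ha

theorem AdjoinRoot.mk_pow_ne_zero {p : F[X]} (hp : Irreducible p) (l : ℕ) :
    AdjoinRoot.mk (p ^ (l + 1)) (p ^ l) ≠ 0 := by
  rw [Ne, AdjoinRoot.mk_eq_zero, pow_dvd_pow_iff hp.ne_zero hp.not_isUnit]
  omega

/-- The class of `p ^ l` lies in every nonzero invariant subspace of `F[X] ⧸ (p ^ (l + 1))`. -/
theorem AdjoinRoot.mk_pow_mem_of_invariant {p : F[X]} (hp : Irreducible p) {l : ℕ}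
    (K : Submodule F (AdjoinRoot (p ^ (l + 1))))
    (hK : ∀ a ∈ K, AdjoinRoot.root (p ^ (l + 1)) * a ∈ K) (hK0 : K ≠ ⊥) :
    AdjoinRoot.mk (p ^ (l + 1)) (p ^ l) ∈ K := by
  obtain ⟨a, ha, ha0⟩ := K.ne_bot_iff.1 hK0
  let K' : Ideal (AdjoinRoot (p ^ (l + 1))) :=
    { K with
      smul_mem' := by
        intro c x hx
        obtain ⟨f, rfl⟩ := AdjoinRoot.mk_surjective c
        change _ ∈ K
        induction f using Polynomial.induction_on' with
        | add f g hf hg => rw [map_add, add_smul]; exact K.add_mem hf hg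
        | monomial n c =>
          induction n with
          | zero =>
            have := K.smul_mem c hx
            rwa [Algebra.smul_def] at this
          | succ n ih =>
            have := hK _ ih
            rw [← Polynomial.monomial_mul_X, map_mul, AdjoinRoot.mk_X, smul_eq_mul,
              mul_comm _ (root _), mul_assoc]
            exact this }
  exact AdjoinRoot.pow_mem_of_mem_ideal hp K' (a := a) ha ha0

/-- Every endomorphism has a direct summand that is multiplication by the root on
`F[X] ⧸ (p ^ (l + 1))` with `p` monic irreducible. -/
theorem Module.End.exists_adjoinRoot_summand {V : Type*} [AddCommGroup V] [Module F V]
    [FiniteDimensional F V] [Nontrivial V] (φ : Module.End F V) :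
    ∃ (p : F[X]) (l : ℕ) (_ : p.Monic) (_ : Irreducible p)
      (i : AdjoinRoot (p ^ (l + 1)) →ₗ[F] V) (π : V →ₗ[F] AdjoinRoot (p ^ (l + 1))),
      (∀ a, π (i a) = a) ∧ (∀ a, i (AdjoinRoot.root _ * a) = φ (i a)) ∧
      ∀ v, π (φ v) = AdjoinRoot.root _ * π v := by
  classical
  obtain ⟨ι, _, p, hp, e, ⟨E⟩⟩ := Module.equiv_directSum_of_isTorsion
    (Module.AEval.isTorsion_of_finiteDimensional F V φ)
  obtain ⟨j, hj⟩ : ∃ j, e j ≠ 0 := by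
    by_contra! h
    have : ∀ j, Subsingleton (F[X] ⧸ Submodule.span F[X] {p j ^ e j}) := by
      intro j
      rw [Submodule.Quotient.subsingleton_iff, h j, pow_zero]
      exact Ideal.span_singleton_one
    have : Subsingleton V := (Module.AEval'.of φ).toEquiv.trans E.toEquiv |>.subsingleton
    exact not_subsingleton V this
  obtain ⟨l, hl⟩ := Nat.exists_eq_succ_of_ne_zero hj
  have hspan : Submodule.span F[X] {p j ^ e j} = Ideal.span {normalize (p j) ^ (l + 1)} := by
    rw [hl]
    exact Ideal.span_singleton_eq_span_singleton.2 ((normalize_associated (p j)).symm.pow_pow)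
  let Q : (F[X] ⧸ Submodule.span F[X] {p j ^ e j}) ≃ₗ[F[X]]
      (F[X] ⧸ Ideal.span {normalize (p j) ^ (l + 1)}) :=
    Submodule.quotEquivOfEq _ _ hspan
  let i₁ := E.symm.toLinearMap ∘ₗ DirectSum.lof F[X] ι _ j ∘ₗ Q.symm.toLinearMap
  let π₁ := Q.toLinearMap ∘ₗ DirectSum.component F[X] ι _ j ∘ₗ E.toLinearMap
  have hπi : ∀ a, π₁ (i₁ a) = a := by
    intro a
    simp only [i₁, π₁, LinearMap.comp_apply, LinearEquiv.coe_coe, LinearEquiv.apply_symm_apply,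
      DirectSum.component.lof_self]
  let J : AdjoinRoot (normalize (p j) ^ (l + 1)) ≃ₗ[F]
      (F[X] ⧸ Ideal.span {normalize (p j) ^ (l + 1)}) := LinearEquiv.refl F _
  have hJ : ∀ a, J (AdjoinRoot.root (normalize (p j) ^ (l + 1)) * a) = (X : F[X]) • J a := by
    intro a
    obtain ⟨f, rfl⟩ := AdjoinRoot.mk_surjective a
    rfl
  refine ⟨normalize (p j), l, monic_normalize (hp j).ne_zero,
    (normalize_associated (p j)).symm.irreducible (hp j),
    (Module.AEval'.of φ).symm.toLinearMap ∘ₗ i₁.restrictScalars F ∘ₗ J.toLinearMap,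
    J.symm.toLinearMap ∘ₗ π₁.restrictScalars F ∘ₗ (Module.AEval'.of φ).toLinearMap, ?_, ?_, ?_⟩
  · intro a
    simp only [LinearMap.comp_apply, LinearEquiv.coe_coe, LinearEquiv.apply_symm_apply,
      LinearMap.restrictScalars_apply, hπi, LinearEquiv.symm_apply_apply]
  · intro a
    simp only [LinearMap.comp_apply, LinearEquiv.coe_coe, LinearMap.restrictScalars_apply, hJ,
      map_smul, Module.AEval'.of_symm_X_smul]
  · intro v
    apply J.injective
    simp only [LinearMap.comp_apply, LinearEquiv.coe_coe, LinearMap.restrictScalars_apply, hJ,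
      LinearEquiv.apply_symm_apply, ← Module.AEval'.X_smul_of, map_smul]

/-- The endomorphism `φ` has a basis in which its matrix is a direct sum of blocks satisfying
`GoodBlock19`. -/
def HasGoodDecomposition {V : Type*} [AddCommGroup V] [Module F V] (φ : Module.End F V) : Prop :=
  ∃ (ι : Type) (_ : Fintype ι) (_ : DecidableEq ι) (d : ι → ℕ)
    (blocks : ∀ i : ι, Matrix (Fin (d i)) (Fin (d i)) F),
    (∀ i, GoodBlock19 (blocks i)) ∧
      ∃ b : Module.Basis (Σ i, Fin (d i)) F V,
        LinearMap.toMatrix b b φ = Matrix.blockDiagonal' blocks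

namespace HasGoodDecomposition

variable {V W : Type*} [AddCommGroup V] [Module F V] [AddCommGroup W] [Module F W]

theorem of_subsingleton [Subsingleton V] (φ : Module.End F V) : HasGoodDecomposition φ :=
  ⟨Empty, inferInstance, inferInstance, fun _ => 0, fun i => i.elim, fun i => i.elim,
    Module.Basis.empty V, Subsingleton.elim _ _⟩

theorem conj {φ : Module.End F V} {ψ : Module.End F W} (e : V ≃ₗ[F] W)
    (he : ∀ v, e (φ v) = ψ (e v)) (h : HasGoodDecomposition φ) : HasGoodDecomposition ψ := by
  obtain ⟨ι, _, _, d, blocks, hg, b, hb⟩ := h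
  refine ⟨ι, inferInstance, inferInstance, d, blocks, hg, b.map e, ?_⟩
  rw [← hb]
  ext i j
  simp [LinearMap.toMatrix_apply, ← he]

theorem of_basis {φ : Module.End F V} {m : ℕ} (b : Module.Basis (Fin m) F V)
    (h : GoodBlock19 (LinearMap.toMatrix b b φ)) : HasGoodDecomposition φ := by
  refine ⟨Unit, inferInstance, inferInstance, fun _ => m, fun _ => LinearMap.toMatrix b b φ,
    fun _ => h, b.reindex (Equiv.uniqueSigma fun _ : Unit => Fin m).symm, ?_⟩
  ext ⟨i, i'⟩ ⟨j, j'⟩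
  obtain rfl : i = j := rfl
  rw [Matrix.blockDiagonal'_apply_eq]
  simp [LinearMap.toMatrix_apply]
  rfl

theorem prodMap {φ : Module.End F V} {ψ : Module.End F W} (hφ : HasGoodDecomposition φ)
    (hψ : HasGoodDecomposition ψ) : HasGoodDecomposition (φ.prodMap ψ : Module.End F (V × W)) := by
  obtain ⟨ι, _, _, d, B, hg, b, hb⟩ := hφ
  obtain ⟨κ, _, _, d', B', hg', b', hb'⟩ := hψ
  let s : (Σ i, Fin (d i)) ⊕ (Σ i, Fin (d' i)) ≃ Σ i, Fin (Sum.elim d d' i) :=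
    (Equiv.sumSigmaDistrib fun i => Fin (Sum.elim d d' i)).symm
  have hl : ∀ i (i' : Fin (d i)), s.symm ⟨Sum.inl i, i'⟩ = Sum.inl ⟨i, i'⟩ := fun _ _ => rfl
  have hr : ∀ i (i' : Fin (d' i)), s.symm ⟨Sum.inr i, i'⟩ = Sum.inr ⟨i, i'⟩ := fun _ _ => rfl
  refine ⟨ι ⊕ κ, inferInstance, inferInstance, Sum.elim d d',
    fun i => Sum.rec (motive := fun i => Matrix (Fin (Sum.elim d d' i)) (Fin (Sum.elim d d' i)) F)
      B B' i, by rintro (i | i) <;> simp [hg, hg'],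
    (b.prod b').reindex s, ?_⟩
  ext ⟨i | i, i'⟩ ⟨j | j, j'⟩ <;>
    rw [LinearMap.toMatrix_apply, Module.Basis.repr_reindex_apply, Module.Basis.reindex_apply,
      Matrix.blockDiagonal'_apply]
  · have := congrFun₂ hb ⟨i, i'⟩ ⟨j, j'⟩
    erw [hl, hl]
    simpa [LinearMap.toMatrix_apply, Matrix.blockDiagonal'_apply] using this
  · erw [hl, hr]
    simp
  · erw [hl, hr]
    simp
  · have := congrFun₂ hb' ⟨i, i'⟩ ⟨j, j'⟩
    erw [hr, hr]
    simpa [LinearMap.toMatrix_apply, Matrix.blockDiagonal'_apply] using this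

theorem exists_matSimilar {n : ℕ} {A : Matrix (Fin n) (Fin n) F}
    (h : HasGoodDecomposition (Matrix.toLin' A)) :
    ∃ (k : ℕ) (d : Fin k → ℕ) (blocks : ∀ i : Fin k, Matrix (Fin (d i)) (Fin (d i)) F),
      (∀ i : Fin k, GoodBlock19 (blocks i)) ∧
      ∃ e : Fin n ≃ (Σ i : Fin k, Fin (d i)),
        MatSimilar A (Matrix.reindex e.symm e.symm (Matrix.blockDiagonal' blocks)) := by
  obtain ⟨ι, _, _, d, B, hg, b, hb⟩ := h
  let f := (Fintype.equivFin ι).symm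
  let s : (Σ i, Fin (d (f i))) ≃ (Σ i, Fin (d i)) :=
    Equiv.sigmaCongrLeft (β := fun i => Fin (d i)) f
  have hcard : Fintype.card (Fin n) = Fintype.card (Σ i, Fin (d (f i))) := by
    rw [Fintype.card_congr s, ← Module.finrank_eq_card_basis b, Module.finrank_fin_fun,
      Fintype.card_fin]
  let e := Fintype.equivOfCardEq hcard
  let c := b.reindex (e.trans s).symm
  refine ⟨Fintype.card ι, fun i => d (f i), fun i => B (f i), fun i => hg _, e,
    (Pi.basisFun F (Fin n)).toMatrix c, ?_, ?_⟩
  · exact IsUnit.of_mul_eq_one _ (Module.Basis.toMatrix_mul_toMatrix_flip _ _)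
  · have hinv : ((Pi.basisFun F (Fin n)).toMatrix c)⁻¹ = c.toMatrix (Pi.basisFun F (Fin n)) :=
      Matrix.inv_eq_left_inv (Module.Basis.toMatrix_mul_toMatrix_flip _ _)
    have hA : A = LinearMap.toMatrix (Pi.basisFun F (Fin n)) (Pi.basisFun F (Fin n))
        (Matrix.toLin' A) := by
      rw [LinearMap.toMatrix_eq_toMatrix', LinearMap.toMatrix'_toLin']
    rw [hinv]
    conv_lhs => rw [hA]
    rw [basis_toMatrix_mul_linearMap_toMatrix_mul_basis_toMatrix]
    have h1 : LinearMap.toMatrix c c (Matrix.toLin' A) =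
        Matrix.reindex (e.trans s).symm (e.trans s).symm (Matrix.blockDiagonal' B) := by
      rw [← hb]
      ext i j
      simp [LinearMap.toMatrix_apply, c, Module.Basis.repr_reindex_apply,
        -Module.Basis.repr_reindex]
    rw [h1]
    ext i j
    simp only [Matrix.reindex_apply, Matrix.submatrix_apply, Equiv.symm_symm, Equiv.trans_apply]
    generalize e i = x
    generalize e j = y
    obtain ⟨x, x'⟩ := x
    obtain ⟨y, y'⟩ := y
    by_cases hxy : x = y
    · subst hxy
      simp [s, Matrix.blockDiagonal'_apply_eq]
    · rw [Matrix.blockDiagonal'_apply_ne _ _ _ hxy]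
      exact Matrix.blockDiagonal'_apply_ne _ _ _ (f.injective.ne hxy)

end HasGoodDecomposition

theorem toMatrix_root_mul_powerBasis {q : F[X]} (hq : q.Monic) :
    LinearMap.toMatrix (AdjoinRoot.powerBasisAux' hq) (AdjoinRoot.powerBasisAux' hq)
      (LinearMap.mulLeft F (AdjoinRoot.root q)) = companion q := by
  have h := (AdjoinRoot.powerBasis' hq).leftMulMatrix
  have hmin : (AdjoinRoot.powerBasis' hq).minpolyGen = q := by
    rw [PowerBasis.minpolyGen_eq, AdjoinRoot.powerBasis'_gen]
    exact (minpoly.unique' F _ hq (by simp) fun r hr => by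
      rw [or_iff_not_imp_left]
      intro hr0 h0
      rw [AdjoinRoot.aeval_eq, AdjoinRoot.mk_eq_zero] at h0
      exact (Polynomial.degree_le_of_dvd h0 hr0).not_gt hr).symm
  rw [hmin, Algebra.leftMulMatrix_apply] at h
  ext i j
  have hij := congrFun (congrFun h i) j
  have hj : (j : ℕ) + 1 = q.natDegree ↔ (j : ℕ) = q.natDegree - 1 := by omega
  refine Eq.trans hij ?_
  change (if (j : ℕ) + 1 = q.natDegree then -q.coeff i else if (i : ℕ) = j + 1 then 1 else 0) =
    if (j : ℕ) = q.natDegree - 1 then -q.coeff i else if (i : ℕ) = j + 1 then 1 else 0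
  simp only [hj]

theorem IsFrobeniusBlock.companion_pow {p : F[X]} (hm : p.Monic) (hp : Irreducible p) (l : ℕ) :
    IsFrobeniusBlock (companion (p ^ (l + 1))) :=
  ⟨p, l + 1, hm, hp, by omega, rfl, rfl⟩

section Bilinear

variable {V : Type*} [AddCommGroup V] [Module F V]

/-- The right orthogonal complement of a subspace with respect to a bilinear form that need not be
reflexive. -/
def rightOrthogonal (B : V →ₗ[F] V →ₗ[F] F) (W : Submodule F V) : Submodule F V :=
  LinearMap.ker (W.dualRestrict ∘ₗ B.flip)

variable {B : V →ₗ[F] V →ₗ[F] F} {φ : Module.End F V} {W : Submodule F V}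

theorem mem_rightOrthogonal {y : V} : y ∈ rightOrthogonal B W ↔ ∀ x ∈ W, B x y = 0 := by
  simp [rightOrthogonal, LinearMap.ext_iff]

theorem finrank_le_add_finrank_rightOrthogonal [FiniteDimensional F V] :
    Module.finrank F V ≤ Module.finrank F W + Module.finrank F (rightOrthogonal B W) := by
  have h := LinearMap.finrank_range_add_finrank_ker (W.dualRestrict ∘ₗ B.flip)
  have h' := Submodule.finrank_le (LinearMap.range (W.dualRestrict ∘ₗ B.flip))
  rw [Subspace.dual_finrank_eq] at h'
  rw [rightOrthogonal]
  omega

theorem asymmetry_isometry (hφ : ∀ x y, B (φ x) y = B y x) (x y : V) : B (φ x) (φ y) = B x y := by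
  rw [hφ, hφ]

theorem asymmetry_injective (hB : ∀ y, (∀ x, B x y = 0) → y = 0)
    (hφ : ∀ x y, B (φ x) y = B y x) : Function.Injective φ := by
  rw [injective_iff_map_eq_zero]
  intro x hx
  refine hB x fun y => ?_
  rw [← hφ, hx, map_zero, LinearMap.zero_apply]

theorem exists_preimage_of_invariant [FiniteDimensional F V] (hi : Function.Injective φ)
    (hW : ∀ x ∈ W, φ x ∈ W) {x : V} (hx : x ∈ W) : ∃ x' ∈ W, φ x' = x := by
  have h : Function.Injective (φ.restrict hW) := fun a b hab =>
    Subtype.ext (hi (congrArg Subtype.val hab))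
  obtain ⟨x', hx'⟩ := LinearMap.injective_iff_surjective.1 h ⟨x, hx⟩
  exact ⟨x', x'.2, congrArg Subtype.val hx'⟩

theorem map_mem_rightOrthogonal [FiniteDimensional F V] (hB : ∀ y, (∀ x, B x y = 0) → y = 0)
    (hφ : ∀ x y, B (φ x) y = B y x) (hW : ∀ x ∈ W, φ x ∈ W) {y : V}
    (hy : y ∈ rightOrthogonal B W) : φ y ∈ rightOrthogonal B W := by
  rw [mem_rightOrthogonal] at hy ⊢
  intro x hx
  obtain ⟨z, hz, rfl⟩ := exists_preimage_of_invariant (asymmetry_injective hB hφ) hW hx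
  rw [asymmetry_isometry hφ, hy z hz]

/-- An invariant subspace on which the form is nondegenerate splits off together with its
orthogonal complement. -/
theorem HasGoodDecomposition.of_orthogonal [FiniteDimensional F V] {A : Type*} [AddCommGroup A]
    [Module F A] [FiniteDimensional F A] {α : Module.End F A} (i : A →ₗ[F] V)
    (hB : ∀ y, (∀ x, B x y = 0) → y = 0) (hφ : ∀ x y, B (φ x) y = B y x)
    (hi : ∀ a, i (α a) = φ (i a)) (hA : ∀ a, (∀ a', B (i a') (i a) = 0) → a = 0)
    (hα : HasGoodDecomposition α)
    (ih : ∀ (W : Submodule F V) (ψ : Module.End F W),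
      Module.finrank F W + Module.finrank F A ≤ Module.finrank F V →
      (∀ y : W, (∀ x : W, B x y = 0) → y = 0) →
      (∀ x y : W, B (ψ x) y = B y x) → HasGoodDecomposition ψ) :
    HasGoodDecomposition φ := by
  set R := LinearMap.range i with hR
  have hRinv : ∀ x ∈ R, φ x ∈ R := by
    rintro _ ⟨a, rfl⟩
    exact ⟨α a, hi a⟩
  set P := rightOrthogonal B R with hP
  have hPinv : ∀ y ∈ P, φ y ∈ P := fun y hy => map_mem_rightOrthogonal hB hφ hRinv hy
  have hi0 : Function.Injective i := by
    rw [injective_iff_map_eq_zero]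
    intro a ha
    exact hA a fun a' => by rw [ha, map_zero]
  let f : A × P →ₗ[F] V := i.coprod P.subtype
  have hf : Function.Injective f := by
    rw [injective_iff_map_eq_zero]
    rintro ⟨a, y⟩ h
    have h1 : i a = -(y : V) := eq_neg_of_add_eq_zero_left (by simpa [f] using h)
    have ha : a = 0 := hA a fun a' => by
      rw [h1, map_neg, mem_rightOrthogonal.1 y.2 _ ⟨a', rfl⟩, neg_zero]
    subst ha
    simpa using h1
  have hdim : Module.finrank F (A × P) = Module.finrank F V := by
    refine le_antisymm (LinearMap.finrank_le_finrank_of_injective hf) ?_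
    rw [Module.finrank_prod]
    refine (finrank_le_add_finrank_rightOrthogonal (B := B) (W := R)).trans ?_
    exact Nat.add_le_add_right (LinearMap.finrank_range_le i) _
  let E := LinearMap.linearEquivOfInjective f hf hdim
  have hE : ∀ x, E x = f x := fun x => rfl
  have hPgood : HasGoodDecomposition (φ.restrict hPinv) := by
    refine ih P _ ?_ ?_ ?_
    · rw [← hdim, Module.finrank_prod, add_comm]
    · intro y hy
      refine Subtype.ext (hB y fun x => ?_)
      obtain ⟨⟨a, z⟩, rfl⟩ := E.surjective x
      have h1 := mem_rightOrthogonal.1 y.2 _ ⟨a, rfl⟩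
      simp [hE, f, h1, hy z]
    · intro x y
      exact hφ x y
  refine (hα.prodMap hPgood).conj E ?_
  rintro ⟨a, y⟩
  simp [hE, f, hi]

end Bilinear

theorem isCosquare_toMatrix {A : Type*} [AddCommGroup A] [Module F A] {α : Module.End F A} {m : ℕ}
    (b : Module.Basis (Fin m) F A) (B : A →ₗ[F] A →ₗ[F] F)
    (hB : ∀ y, (∀ x, B x y = 0) → y = 0) (hα : ∀ x y, B (α x) y = B y x) :
    IsCosquare (LinearMap.toMatrix b b α) := by
  set Q := LinearMap.toMatrix₂ b b B with hQ
  set C := LinearMap.toMatrix b b α with hC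
  have h1 : Cᵀ * Q = Qᵀ := by
    rw [hC, hQ, ← LinearMap.toMatrix₂_comp]
    ext i j
    simp [LinearMap.toMatrix₂_apply, hα]
  have hdet : Q.det ≠ 0 := by
    have h : B.flip.SeparatingLeft := LinearMap.flip_separatingLeft.2 hB
    rw [LinearMap.separatingLeft_iff_det_ne_zero b] at h
    have h2 : LinearMap.toMatrix₂ b b B.flip = Qᵀ := by
      ext i j
      simp [hQ, LinearMap.toMatrix₂_apply]
    rwa [h2, Matrix.det_transpose] at h
  have hu : IsUnit Q.det := hdet.isUnit
  refine ⟨Q, (Matrix.isUnit_iff_isUnit_det Q).2 hu, ?_⟩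
  have h3 : Qᵀ * C = Q := by
    rw [← Matrix.transpose_inj, Matrix.transpose_mul, Matrix.transpose_transpose, h1]
  have hut : IsUnit Qᵀ.det := by rwa [Matrix.det_transpose]
  have h4 := Matrix.nonsing_inv_mul_cancel_left (A := Qᵀ) C hut
  rwa [h3, ← Matrix.transpose_nonsing_inv] at h4

/-- The direct sum of a Frobenius block with its contragredient has a good decomposition, whether
or not the block is a cosquare. -/
theorem HasGoodDecomposition.prodMap_contragredient {A U : Type*} [AddCommGroup A] [Module F A]
    [AddCommGroup U] [Module F U] {α : Module.End F A} {ψ : Module.End F U} {m : ℕ}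
    {C : Matrix (Fin m) (Fin m) F} (hC : IsFrobeniusBlock C) (hCu : IsUnit C)
    (b : Module.Basis (Fin m) F A) (c : Module.Basis (Fin m) F U)
    (hα : LinearMap.toMatrix b b α = C) (hψ : LinearMap.toMatrix c c ψ = C⁻¹ᵀ) :
    HasGoodDecomposition (α.prodMap ψ : Module.End F (A × U)) := by
  by_cases hcos : IsCosquare C
  · have hαg : HasGoodDecomposition α := .of_basis b (Or.inr (by rw [hα]; exact ⟨hC, hcos⟩))
    obtain ⟨Q, hQ, rfl⟩ := hcos
    have hQd : IsUnit Q.det := (Matrix.isUnit_iff_isUnit_det Q).1 hQ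
    have hQdt : IsUnit Qᵀ.det := by rwa [Matrix.det_transpose]
    let e : A ≃ₗ[F] U := Matrix.toLinOfInv b c (Matrix.mul_nonsing_inv Q hQd)
      (Matrix.nonsing_inv_mul Q hQd)
    have he : ∀ v, e v = Matrix.toLin b c Q v := fun _ => rfl
    have hcomm : Q * (Q⁻¹ᵀ * Q) = (Q⁻¹ᵀ * Q)⁻¹ᵀ * Q := by
      rw [Matrix.mul_inv_rev, Matrix.transpose_mul, Matrix.transpose_nonsing_inv Q,
        Matrix.nonsing_inv_nonsing_inv _ hQdt, Matrix.transpose_transpose,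
        ← Matrix.transpose_nonsing_inv, Matrix.mul_assoc]
    refine hαg.prodMap (hαg.conj e fun v => ?_)
    have h1 : α = Matrix.toLin b b (Q⁻¹ᵀ * Q) := by rw [← hα, Matrix.toLin_toMatrix]
    have h2 : ψ = Matrix.toLin c c (Q⁻¹ᵀ * Q)⁻¹ᵀ := by rw [← hψ, Matrix.toLin_toMatrix]
    rw [he, he, h1, h2, ← LinearMap.comp_apply, ← LinearMap.comp_apply,
      ← Matrix.toLin_mul, ← Matrix.toLin_mul, hcomm]
  · refine .of_basis ((b.prod c).reindex finSumFinEquiv) (Or.inl ⟨m, rfl, C, hC, hCu, hcos, ?_⟩)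
    rw [← hψ, ← hα]
    ext i j
    obtain ⟨i, rfl⟩ := finSumFinEquiv.surjective i
    obtain ⟨j, rfl⟩ := finSumFinEquiv.surjective j
    rw [LinearMap.toMatrix_apply, Module.Basis.repr_reindex_apply, Module.Basis.reindex_apply,
      finCongr_refl, Matrix.reindex_refl_refl, dSum, Matrix.reindex_apply, Matrix.submatrix_apply,
      Equiv.symm_apply_apply, Equiv.symm_apply_apply]
    rcases i with i | i <;> rcases j with j | j <;>
      simp [LinearMap.toMatrix_apply]

theorem HasGoodDecomposition.prodMap_of_pairing {A U : Type*} [AddCommGroup A] [Module F A]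
    [AddCommGroup U] [Module F U] [FiniteDimensional F U]
    {α : Module.End F A} {ψ : Module.End F U} {m : ℕ} (b : Module.Basis (Fin m) F A)
    (hC : IsFrobeniusBlock (LinearMap.toMatrix b b α))
    (P : A →ₗ[F] U →ₗ[F] F) (hP : Function.Bijective P.flip)
    (hαψ : ∀ a u, P (α a) (ψ u) = P a u) :
    HasGoodDecomposition (α.prodMap ψ : Module.End F (A × U)) := by
  let e : U ≃ₗ[F] Module.Dual F A := LinearEquiv.ofBijective P.flip hP
  let c : Module.Basis (Fin m) F U := b.dualBasis.map e.symm
  have hbc : LinearMap.toMatrix₂ b c P = 1 := by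
    ext i j
    have h : P (b i) (c j) = e (c j) (b i) := rfl
    rw [LinearMap.toMatrix₂_apply, h]
    simp [c, Matrix.one_apply, Finsupp.single_apply]
  have h : (LinearMap.toMatrix b b α)ᵀ * LinearMap.toMatrix c c ψ = 1 := by
    have h' : P.compl₁₂ α ψ = P := by
      ext a u
      exact hαψ a u
    have := LinearMap.toMatrix₂_compl₁₂ b c b c P α ψ
    rw [h', hbc, mul_one] at this
    exact this.symm
  refine .prodMap_contragredient hC ?_ b c rfl ?_
  · rw [← Matrix.isUnit_transpose]
    exact IsUnit.of_mul_eq_one _ h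
  · rw [Matrix.transpose_nonsing_inv]
    exact (Matrix.inv_eq_right_inv h).symm

/-- The asymmetry of a nondegenerate bilinear form has a good decomposition. -/
theorem HasGoodDecomposition.of_asymmetry {V : Type*} [AddCommGroup V] [Module F V]
    [FiniteDimensional F V] (B : V →ₗ[F] V →ₗ[F] F) (φ : Module.End F V)
    (hB : ∀ y, (∀ x, B x y = 0) → y = 0) (hφ : ∀ x y, B (φ x) y = B y x) :
    HasGoodDecomposition φ := by
  induction hn : Module.finrank F V using Nat.strong_induction_on generalizing V with
  | _ n ih =>
  subst hn
  rcases subsingleton_or_nontrivial V with hV | hV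
  · exact .of_subsingleton φ
  obtain ⟨p, l, hm, hp, i, π, hπi, hiα, hπ⟩ := Module.End.exists_adjoinRoot_summand φ
  have hq : (p ^ (l + 1)).Monic := hm.pow _
  set A := AdjoinRoot (p ^ (l + 1))
  have : FiniteDimensional F A := hq.finite_adjoinRoot
  have : Nontrivial A := ⟨_, _, AdjoinRoot.mk_pow_ne_zero hp l⟩
  have hApos : 0 < Module.finrank F A := Module.finrank_pos
  set α : Module.End F A := LinearMap.mulLeft F (AdjoinRoot.root (p ^ (l + 1)))
  have hi : ∀ a, i (α a) = φ (i a) := hiα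
  have hπα : ∀ v, π (φ v) = α (π v) := hπ
  let b := AdjoinRoot.powerBasisAux' hq
  have hb : LinearMap.toMatrix b b α = companion (p ^ (l + 1)) := toMatrix_root_mul_powerBasis hq
  have hF : IsFrobeniusBlock (LinearMap.toMatrix b b α) := by
    rw [hb]
    exact .companion_pow hm hp l
  have ih' : ∀ m, 0 < m → ∀ (W : Submodule F V) (ψ : Module.End F W),
      Module.finrank F W + m ≤ Module.finrank F V →
      (∀ y : W, (∀ x : W, B x y = 0) → y = 0) →
      (∀ x y : W, B (ψ x) y = B y x) → HasGoodDecomposition ψ := fun m hm W ψ hW h1 h2 =>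
    ih (Module.finrank F W) (by omega) (B.domRestrict₁₂ W W) ψ h1 h2 rfl
  by_cases hnd : ∀ a, (∀ a', B (i a') (i a) = 0) → a = 0
  · refine .of_orthogonal i hB hφ hi hnd (.of_basis b (Or.inr ⟨hF, ?_⟩)) (ih' _ hApos)
    refine isCosquare_toMatrix b (B.compl₁₂ i i) hnd fun x y => ?_
    rw [LinearMap.compl₁₂_apply, LinearMap.compl₁₂_apply, hi, hφ]
  have hRinv : ∀ x ∈ LinearMap.range i, φ x ∈ LinearMap.range i := by
    rintro _ ⟨a, rfl⟩
    exact ⟨α a, hi a⟩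
  have hs : ∀ a', B (i a') (i (AdjoinRoot.mk (p ^ (l + 1)) (p ^ l))) = 0 := by
    have h := AdjoinRoot.mk_pow_mem_of_invariant hp
      ((rightOrthogonal B (LinearMap.range i)).comap i) (fun a ha => by
        rw [Submodule.mem_comap, hiα]
        exact map_mem_rightOrthogonal hB hφ hRinv ha) (fun h => hnd fun a ha => by
        rw [← Submodule.mem_bot F, ← h, Submodule.mem_comap, mem_rightOrthogonal]
        rintro _ ⟨a', rfl⟩
        exact ha a')
    exact fun a' => mem_rightOrthogonal.1 h _ ⟨a', rfl⟩
  set s := AdjoinRoot.mk (p ^ (l + 1)) (p ^ l) with hsdef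
  set U := rightOrthogonal B (LinearMap.ker π)
  have hUinv : ∀ u ∈ U, φ u ∈ U := fun u hu =>
    map_mem_rightOrthogonal hB hφ (fun x hx => by
      rw [LinearMap.mem_ker] at hx ⊢
      rw [hπα, hx, map_zero]) hu
  let P : A →ₗ[F] U →ₗ[F] F := B.compl₁₂ i U.subtype
  have hPapp : ∀ a u, P a u = B (i a) u := fun _ _ => rfl
  have hU0 : ∀ u ∈ U, (∀ a, B (i a) u = 0) → u = 0 := by
    intro u hu h
    refine hB u fun x => ?_
    have hx : x - i (π x) ∈ LinearMap.ker π := by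
      rw [LinearMap.mem_ker, map_sub, hπi, sub_self]
    have h2 := mem_rightOrthogonal.1 hu _ hx
    rwa [map_sub, LinearMap.sub_apply, h, sub_zero] at h2
  have hPinj : Function.Injective P.flip := by
    rw [injective_iff_map_eq_zero]
    intro u hu
    exact Subtype.ext (hU0 u u.2 fun a => LinearMap.congr_fun hu a)
  have hPbij : Function.Bijective P.flip := by
    refine ⟨hPinj, ?_⟩
    have h1 := LinearMap.finrank_range_add_finrank_ker π
    have h2 : Module.finrank F V ≤ Module.finrank F (LinearMap.ker π) + Module.finrank F U :=
      finrank_le_add_finrank_rightOrthogonal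
    have h3 : LinearMap.range π = ⊤ := LinearMap.range_eq_top.2 fun a => ⟨i a, hπi a⟩
    rw [h3, finrank_top] at h1
    change Module.finrank F A + _ = _ at h1
    have h4 : Module.finrank F U ≤ Module.finrank F (Module.Dual F A) :=
      LinearMap.finrank_le_finrank_of_injective hPinj
    have h5 : Module.finrank F (Module.Dual F A) = Module.finrank F A :=
      Subspace.dual_finrank_eq
    exact (LinearMap.injective_iff_surjective_of_finrank_eq_finrank
      (show Module.finrank F U = Module.finrank F (Module.Dual F A) by omega)).1 hPinj
  have hA0 : ∀ a, (∀ u ∈ U, B (i a) u = 0) → a = 0 := by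
    intro a ha
    rw [← Module.forall_dual_apply_eq_zero_iff F]
    intro f
    obtain ⟨u, rfl⟩ := hPbij.2 f
    exact ha u u.2
  have hgood : HasGoodDecomposition (α.prodMap (φ.restrict hUinv) : Module.End F (A × U)) := by
    refine .prodMap_of_pairing b hF P hPbij fun a u => ?_
    rw [hPapp, hi]
    exact asymmetry_isometry hφ _ _
  let R := rightOrthogonal B (LinearMap.range i ⊔ U)
  have hRi : ∀ z ∈ R, ∀ a, B (i a) z = 0 := fun z hz a =>
    mem_rightOrthogonal.1 hz _ (Submodule.mem_sup_left ⟨a, rfl⟩)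
  have hRU : ∀ z ∈ R, ∀ u ∈ U, B u z = 0 := fun z hz u hu =>
    mem_rightOrthogonal.1 hz _ (Submodule.mem_sup_right hu)
  have hRφ : ∀ z ∈ R, φ z ∈ R := fun z hz => map_mem_rightOrthogonal hB hφ (fun x hx => by
    obtain ⟨y, hy, u, hu, rfl⟩ := Submodule.mem_sup.1 hx
    rw [map_add]
    exact Submodule.add_mem_sup (hRinv y hy) (hUinv u hu)) hz
  have hK : (U ⊔ R).comap i = ⊥ := by
    by_contra hne
    have h := AdjoinRoot.mk_pow_mem_of_invariant hp ((U ⊔ R).comap i) (fun a ha => by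
      rw [Submodule.mem_comap] at ha ⊢
      obtain ⟨u, hu, z, hz, h⟩ := Submodule.mem_sup.1 ha
      rw [hiα, ← h, map_add]
      exact Submodule.add_mem_sup (hUinv u hu) (hRφ z hz)) hne
    obtain ⟨u, hu, z, hz, h⟩ := Submodule.mem_sup.1 h
    have hu0 : u = 0 := hU0 u hu fun a => by
      have := hs a
      rwa [hsdef, ← h, map_add, hRi z hz, add_zero] at this
    rw [hu0, zero_add] at h
    refine AdjoinRoot.mk_pow_ne_zero hp l (hA0 _ fun u hu => ?_)
    rw [← hφ, ← h]
    exact hRU z hz _ (hUinv u hu)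
  refine .of_orthogonal (i.coprod U.subtype) hB hφ ?_ ?_ hgood (ih' _ ?_)
  · rintro ⟨a, u⟩
    simp [hi]
  · rintro ⟨a, u⟩ h
    have hR : i a + u ∈ R := by
      refine mem_rightOrthogonal.2 fun x hx => ?_
      obtain ⟨_, ⟨a', rfl⟩, u', hu', rfl⟩ := Submodule.mem_sup.1 hx
      exact h (a', ⟨u', hu'⟩)
    have ha : a = 0 := by
      rw [← Submodule.mem_bot F, ← hK, Submodule.mem_comap]
      refine Submodule.mem_sup.2 ⟨-u, U.neg_mem u.2, _, hR, by abel⟩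
    subst ha
    rw [map_zero, zero_add] at hR
    exact Prod.ext rfl (Subtype.ext (hU0 u u.2 (hRi u hR)))
  · rw [Module.finrank_prod]
    exact Nat.add_pos_left hApos _

/-- for an invertible matrix `M` over a field of characteristic not 2,
the cosquare `M⁻ᵀM` is similar to a direct sum of blocks `Φ ⊕ Φ⁻ᵀ` (`Φ` an invertible
Frobenius block that is not a cosquare) and Frobenius blocks that are cosquares. -/
theorem stmt_19 {F : Type*} [Field F] (hchar : (2 : F) ≠ 0) {n : ℕ}
    (M : Matrix (Fin n) (Fin n) F) (hM : IsUnit M) :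
    ∃ (k : ℕ) (d : Fin k → ℕ) (blocks : ∀ i : Fin k, Matrix (Fin (d i)) (Fin (d i)) F),
      (∀ i : Fin k, GoodBlock19 (blocks i)) ∧
      ∃ e : Fin n ≃ (Σ i : Fin k, Fin (d i)),
        MatSimilar (M⁻¹ᵀ * M)
          (Matrix.reindex e.symm e.symm (Matrix.blockDiagonal' blocks)) := by
  have hu : IsUnit M.det := (Matrix.isUnit_iff_isUnit_det M).1 hM
  refine HasGoodDecomposition.exists_matSimilar
    (.of_asymmetry (Matrix.toLinearMap₂' F M) _ (fun y hy => ?_) fun x y => ?_)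
  · have h : M *ᵥ y = 0 := by
      refine dotProduct_eq_zero _ fun x => ?_
      rw [dotProduct_comm, ← Matrix.toLinearMap₂'_apply', hy]
    rw [← Matrix.one_mulVec y, ← Matrix.nonsing_inv_mul M hu, ← Matrix.mulVec_mulVec, h,
      Matrix.mulVec_zero]
  · rw [Matrix.toLinearMap₂'_apply', Matrix.toLinearMap₂'_apply', Matrix.toLin'_apply,
      dotProduct_mulVec, ← Matrix.mulVec_transpose, Matrix.mulVec_mulVec, ← Matrix.mul_assoc,
      ← Matrix.transpose_mul, Matrix.nonsing_inv_mul M hu, Matrix.transpose_one, Matrix.one_mul,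
      dotProduct_comm]
end
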